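/- arXiv:1011.0591 — 7 statements merged into one kernel-verified Lean document; each statement's English description precedes it below -/
import Mathlib

section
/- There is an absolute constant C > 0 such that for all real numbers k ≥ 1, c ≥ 0, and d, e ∈ ℝ, the set {(ξ, n) ∈ ℝ × ℤ : c ≤ (ξ − d)² + (n − e)² ≤ c + k} has measure at most C·k, where ℝ × ℤ carries the product of the one-dimensional Lebesgue measure on ℝ and the counting measure on ℤ. -/
open MeasureTheory

/-- Length of the slice at height `y` of the annulus `c ≤ x² + y² ≤ c + k`. -/
noncomputable def annulusSlice (c k y : ℝ) : ℝ :=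
  2 * (√(c + k - y ^ 2) - √(c - y ^ 2))

lemma volume_slice_le (k c d y : ℝ) (hk : 0 ≤ k) :
    volume {x : ℝ | c ≤ (x - d) ^ 2 + y ^ 2 ∧ (x - d) ^ 2 + y ^ 2 ≤ c + k}
      ≤ ENNReal.ofReal (annulusSlice c k y) := by
  have huv : √(c - y ^ 2) ≤ √(c + k - y ^ 2) := Real.sqrt_le_sqrt (by linarith)
  unfold annulusSlice
  set u := √(c - y ^ 2)
  set v := √(c + k - y ^ 2)
  calc _ ≤ volume (Set.Icc (d + u) (d + v) ∪ Set.Icc (d - v) (d - u)) := by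
        refine measure_mono fun x ⟨h₁, h₂⟩ => ?_
        have hv : |x - d| ≤ v := Real.abs_le_sqrt (by linarith)
        have hu : u ≤ |x - d| := by
          rw [← Real.sqrt_sq_eq_abs]
          exact Real.sqrt_le_sqrt (by linarith)
        rcases le_total 0 (x - d) with h | h
        · rw [abs_of_nonneg h] at hu hv
          exact Or.inl ⟨by linarith, by linarith⟩
        · rw [abs_of_nonpos h] at hu hv
          exact Or.inr ⟨by linarith, by linarith⟩
    _ ≤ _ := measure_union_le _ _
    _ = _ := by
        rw [Real.volume_Icc, Real.volume_Icc, ← ENNReal.ofReal_add (by linarith) (by linarith)]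
        ring_nf

lemma sqrt_sub_sqrt_le_sqrt_sub {a b : ℝ} (hba : b ≤ a) : √a - √b ≤ √(a - b) := by
  rw [sub_le_iff_le_add, Real.sqrt_le_left (by positivity)]
  have h := Real.sq_sqrt (sub_nonneg.2 hba)
  have hb : b ≤ √b ^ 2 := by
    rcases le_total 0 b with h0 | h0
    · rw [Real.sq_sqrt h0]
    · exact h0.trans (sq_nonneg _)
  nlinarith [mul_nonneg (Real.sqrt_nonneg (a - b)) (Real.sqrt_nonneg b)]

/-- A bounded function whose unit increments dominate `annulusSlice` on `0 ≤ y`. -/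
noncomputable def slicePrimitive (c k y : ℝ) : ℝ :=
  -(4 * k / √√c * √(√c - y)) + 2 * √k * min (max y (√c - 1)) (√(c + k) + 1)

lemma annulusSlice_le_increment {c k y : ℝ} (hc : 0 ≤ c) (hk : 0 ≤ k) (hy : 0 ≤ y) :
    annulusSlice c k y ≤ slicePrimitive c k (y + 1) - slicePrimitive c k y := by
  have hcs : √c ^ 2 = c := Real.sq_sqrt hc
  have hs0 : 0 ≤ √c := Real.sqrt_nonneg c
  have hsr : √c ≤ √(c + k) := Real.sqrt_le_sqrt (by linarith)
  have hrs : √(c + k) ^ 2 = c + k := Real.sq_sqrt (by linarith)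
  have hG : 0 ≤ 4 * k / √√c * (√(√c - y) - √(√c - (y + 1))) :=
    mul_nonneg (by positivity) (sub_nonneg.2 (Real.sqrt_le_sqrt (by linarith)))
  have hH : 0 ≤ 2 * √k * (min (max (y + 1) (√c - 1)) (√(c + k) + 1)
      - min (max y (√c - 1)) (√(c + k) + 1)) :=
    mul_nonneg (by positivity) (sub_nonneg.2
      (min_le_min_right _ (max_le_max_right _ (by linarith))))
  have hsplit : slicePrimitive c k (y + 1) - slicePrimitive c k y =
      4 * k / √√c * (√(√c - y) - √(√c - (y + 1))) +
      2 * √k * (min (max (y + 1) (√c - 1)) (√(c + k) + 1)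
      - min (max y (√c - 1)) (√(c + k) + 1)) := by
    unfold slicePrimitive; ring
  rw [hsplit]
  unfold annulusSlice
  rcases le_or_gt y (√c - 1) with h₁ | h₁
  · refine le_add_of_le_of_nonneg ?_ hH
    have hs : 0 < √c := by linarith
    have hA : 0 < √√c := Real.sqrt_pos.2 hs
    have ht : 0 < √(√c - y) := Real.sqrt_pos.2 (by linarith)
    have hAt : √√c * √(√c - y) ≤ √(c - y ^ 2) := by
      rw [← Real.sqrt_mul hs0]
      exact Real.sqrt_le_sqrt (by nlinarith)
    have hw : 0 < √(c - y ^ 2) := lt_of_lt_of_le (mul_pos hA ht) hAt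
    have hwsq : √(c - y ^ 2) ^ 2 = c - y ^ 2 := Real.sq_sqrt (Real.sqrt_pos.1 hw).le
    have hvsq : √(c + k - y ^ 2) ^ 2 = c + k - y ^ 2 :=
      Real.sq_sqrt (by linarith [(Real.sqrt_pos.1 hw).le])
    have hvw : √(c - y ^ 2) ≤ √(c + k - y ^ 2) := Real.sqrt_le_sqrt (by linarith)
    have hslice : (√(c + k - y ^ 2) - √(c - y ^ 2)) * √(c - y ^ 2) ≤ k := by
      nlinarith
    have hinc : 1 ≤ 2 * (√(√c - y) - √(√c - (y + 1))) * √(√c - y) := by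
      have e₁ : √(√c - y) ^ 2 = √c - y := Real.sq_sqrt (by linarith)
      have e₂ : √(√c - (y + 1)) ^ 2 = √c - (y + 1) := Real.sq_sqrt (by linarith)
      nlinarith [sq_nonneg (√(√c - y) - √(√c - (y + 1)))]
    calc 2 * (√(c + k - y ^ 2) - √(c - y ^ 2))
        ≤ 2 * (k / (√√c * √(√c - y))) := by
          gcongr
          rw [le_div_iff₀ (mul_pos hA ht)]
          exact (mul_le_mul_of_nonneg_left hAt (sub_nonneg.2 hvw)).trans hslice
      _ = 2 * k / √√c * (1 / √(√c - y)) := by field_simp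
      _ ≤ 2 * k / √√c * (2 * (√(√c - y) - √(√c - (y + 1)))) := by
          gcongr
          rwa [div_le_iff₀ ht]
      _ = _ := by ring
  · refine le_add_of_nonneg_of_le hG ?_
    rcases le_or_gt y (√(c + k)) with h₂ | h₂
    · rw [max_eq_left (by linarith), max_eq_left h₁.le, min_eq_left (by linarith),
        min_eq_left (by linarith)]
      have h := sqrt_sub_sqrt_le_sqrt_sub (show c - y ^ 2 ≤ c + k - y ^ 2 by linarith)
      rw [show c + k - y ^ 2 - (c - y ^ 2) = k by ring] at h
      linarith
    · have hneg : c + k - y ^ 2 ≤ 0 := by nlinarith [Real.sqrt_nonneg (c + k)]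
      rw [Real.sqrt_eq_zero_of_nonpos hneg]
      linarith [Real.sqrt_nonneg (c - y ^ 2)]

lemma slicePrimitive_sub_le {c k x y : ℝ} (hk : 1 ≤ k) (hy : 0 ≤ y) :
    slicePrimitive c k x - slicePrimitive c k y ≤ 10 * k := by
  have hk0 : 0 ≤ k := by linarith
  have hG : 4 * k / √√c * √(√c - y) ≤ 4 * k := by
    have h : √(√c - y) ≤ √√c := Real.sqrt_le_sqrt (by linarith)
    rw [div_mul_eq_mul_div]
    exact div_le_of_le_mul₀ (Real.sqrt_nonneg _) (by positivity) (by gcongr)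
  have hG' : 0 ≤ 4 * k / √√c * √(√c - x) := by positivity
  have hsr : √c ≤ √(c + k) := Real.sqrt_le_sqrt (by linarith)
  have hr : √(c + k) - √c ≤ √k := by
    simpa using sqrt_sub_sqrt_le_sqrt_sub (show c ≤ c + k by linarith)
  have hx : min (max x (√c - 1)) (√(c + k) + 1) ≤ √(c + k) + 1 := min_le_right _ _
  have hy' : √c - 1 ≤ min (max y (√c - 1)) (√(c + k) + 1) :=
    le_min (le_max_right _ _) (by linarith)
  have hk1 : 1 ≤ √k := Real.one_le_sqrt.2 hk
  have hkk : √k ^ 2 = k := Real.sq_sqrt hk0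
  have hH : 2 * √k * (min (max x (√c - 1)) (√(c + k) + 1)
      - min (max y (√c - 1)) (√(c + k) + 1)) ≤ 2 * √k * (√k + 2) := by
    gcongr
    linarith
  unfold slicePrimitive
  nlinarith

lemma tsum_annulusSlice_le {c k a : ℝ} (hc : 0 ≤ c) (hk : 1 ≤ k) (ha : 0 ≤ a) :
    ∑' m : ℕ, ENNReal.ofReal (annulusSlice c k (m + a)) ≤ ENNReal.ofReal (10 * k) := by
  refine ENNReal.tsum_le_of_sum_range_le fun N => ?_
  rw [← ENNReal.ofReal_sum_of_nonneg]
  · refine ENNReal.ofReal_le_ofReal ?_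
    calc ∑ m ∈ Finset.range N, annulusSlice c k (m + a)
        ≤ ∑ m ∈ Finset.range N,
            (slicePrimitive c k ((m + 1 : ℕ) + a) - slicePrimitive c k (m + a)) := by
          refine Finset.sum_le_sum fun m _ => ?_
          rw [Nat.cast_succ, add_right_comm]
          exact annulusSlice_le_increment hc (by linarith) (by positivity)
      _ = slicePrimitive c k (N + a) - slicePrimitive c k ((0 : ℕ) + a) :=
          Finset.sum_range_sub (fun m : ℕ => slicePrimitive c k (m + a)) N
      _ ≤ 10 * k := slicePrimitive_sub_le hk (by simpa using ha)
  · intro m _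
    exact mul_nonneg zero_le_two (sub_nonneg.2 (Real.sqrt_le_sqrt (by linarith)))

/-- There is an absolute constant `C > 0` such that for all real `k ≥ 1`, `c ≥ 0`, `d e : ℝ`,
the set `{(ξ, n) ∈ ℝ × ℤ : c ≤ (ξ − d)² + (n − e)² ≤ c + k}` has measure at most `C k`
with respect to the product of Lebesgue measure on `ℝ` and counting measure on `ℤ`. -/
theorem stmt_2 :
    ∃ C : ℝ, 0 < C ∧ ∀ k c d e : ℝ, 1 ≤ k → 0 ≤ c →
      ((volume : Measure ℝ).prod (Measure.count : Measure ℤ))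
        {p : ℝ × ℤ | c ≤ (p.1 - d) ^ 2 + ((p.2 : ℝ) - e) ^ 2 ∧
          (p.1 - d) ^ 2 + ((p.2 : ℝ) - e) ^ 2 ≤ c + k}
      ≤ ENNReal.ofReal (C * k) := by
  refine ⟨20, by norm_num, fun k c d e hk hc => ?_⟩
  have hmeas : MeasurableSet {p : ℝ × ℤ | c ≤ (p.1 - d) ^ 2 + ((p.2 : ℝ) - e) ^ 2 ∧
      (p.1 - d) ^ 2 + ((p.2 : ℝ) - e) ^ 2 ≤ c + k} := by
    have hcast : Measurable fun p : ℝ × ℤ => (p.2 : ℝ) :=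
      (measurable_of_countable fun n : ℤ => (n : ℝ)).comp measurable_snd
    have hf : Measurable fun p : ℝ × ℤ => (p.1 - d) ^ 2 + ((p.2 : ℝ) - e) ^ 2 := by fun_prop
    exact (measurableSet_le measurable_const hf).inter (measurableSet_le hf measurable_const)
  rw [Measure.prod_apply_symm hmeas, lintegral_count]
  have hceil := Int.le_ceil e
  have hceil' := Int.ceil_lt_add_one e
  calc _ ≤ ∑' n : ℤ, ENNReal.ofReal (annulusSlice c k (n - e)) :=
        ENNReal.tsum_le_tsum fun n => volume_slice_le k c d (n - e) (by linarith)
    _ = ∑' n : ℤ, ENNReal.ofReal (annulusSlice c k ((n + ⌈e⌉ : ℤ) - e)) :=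
        ((Equiv.addRight ⌈e⌉).tsum_eq
          fun n : ℤ => ENNReal.ofReal (annulusSlice c k (n - e))).symm
    _ = ∑' m : ℕ, ENNReal.ofReal (annulusSlice c k (m + (⌈e⌉ - e))) +
        ∑' m : ℕ, ENNReal.ofReal (annulusSlice c k (m + (1 - (⌈e⌉ - e)))) := by
        rw [tsum_of_nat_of_neg_add_one ENNReal.summable ENNReal.summable]
        congr 1 <;> refine tsum_congr fun m => ?_ <;> congr 1
        · push_cast
          rw [add_sub_assoc]
        · unfold annulusSlice
          push_cast
          ring_nf
    _ ≤ ENNReal.ofReal (10 * k) + ENNReal.ofReal (10 * k) :=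
        add_le_add (tsum_annulusSlice_le hc hk (by linarith))
          (tsum_annulusSlice_le hc hk (by linarith))
    _ = ENNReal.ofReal (20 * k) := by
        rw [← ENNReal.ofReal_add (by linarith) (by linarith)]
        ring_nf
end

section
/- There is an absolute constant C > 0 such that for every real c ≥ 1 and every e ∈ [0, 1), one has Σ_{n ∈ ℤ, (n − e)² ≤ c} ( √(c + 1 − (n − e)²) − √(c − (n − e)²) ) ≤ C. -/
/-- The increment `√(c + 1 - x²) - √(c - x²)`, extended by zero outside `x² ≤ c`. -/
noncomputable def sqrtGap (c x : ℝ) : ℝ :=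
  if x ^ 2 ≤ c then Real.sqrt (c + 1 - x ^ 2) - Real.sqrt (c - x ^ 2) else 0

/-- A decreasing function whose unit decrements dominate `sqrtGap (R ^ 2)` on `[0, ∞)`. -/
noncomputable def gapMajorant (R x : ℝ) : ℝ :=
  if x ≤ R then 1 + Real.sqrt (R - x) / Real.sqrt R else 0

lemma sqrtGap_neg (c x : ℝ) : sqrtGap c (-x) = sqrtGap c x := by
  simp [sqrtGap]

lemma sqrtGap_nonneg (c x : ℝ) : 0 ≤ sqrtGap c x := by
  unfold sqrtGap
  split_ifs
  · exact sub_nonneg.2 (Real.sqrt_le_sqrt (by linarith))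
  · exact le_rfl

lemma gapMajorant_nonneg (R x : ℝ) : 0 ≤ gapMajorant R x := by
  unfold gapMajorant
  split_ifs <;> positivity

lemma gapMajorant_le_two {R x : ℝ} (hx : 0 ≤ x) : gapMajorant R x ≤ 2 := by
  unfold gapMajorant
  split_ifs
  · have : Real.sqrt (R - x) / Real.sqrt R ≤ 1 :=
      div_le_one_of_le₀ (Real.sqrt_le_sqrt (by linarith)) (Real.sqrt_nonneg _)
    linarith
  · norm_num

lemma sqrt_add_one_sub_sqrt_le_one {a : ℝ} (ha : 0 ≤ a) :
    Real.sqrt (a + 1) - Real.sqrt a ≤ 1 := by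
  rw [sub_le_iff_le_add, Real.sqrt_le_left (by positivity)]
  nlinarith [Real.sq_sqrt ha, Real.sqrt_nonneg a]

lemma sqrt_add_one_sub_sqrt_le {a : ℝ} (ha : 0 < a) :
    Real.sqrt (a + 1) - Real.sqrt a ≤ 1 / (2 * Real.sqrt a) := by
  have hs : 0 < Real.sqrt a := Real.sqrt_pos.2 ha
  rw [sub_le_iff_le_add, Real.sqrt_le_left (by positivity)]
  have h : (1 / (2 * Real.sqrt a) + Real.sqrt a) ^ 2
      = (1 / (2 * Real.sqrt a)) ^ 2 + 1 + Real.sqrt a ^ 2 := by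
    field_simp
    ring
  rw [h, Real.sq_sqrt ha.le]
  nlinarith [sq_nonneg (1 / (2 * Real.sqrt a))]

lemma le_sqrt_sub_sqrt_sub_one {t : ℝ} (ht : 1 ≤ t) :
    1 / (2 * Real.sqrt t) ≤ Real.sqrt t - Real.sqrt (t - 1) := by
  have hs : 0 < Real.sqrt t := Real.sqrt_pos.2 (by linarith)
  rw [div_le_iff₀ (by positivity)]
  nlinarith [Real.sq_sqrt (show 0 ≤ t by linarith), Real.sq_sqrt (show 0 ≤ t - 1 by linarith),
    sq_nonneg (Real.sqrt t - Real.sqrt (t - 1))]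

lemma sqrtGap_le_gapMajorant_sub {R x : ℝ} (hR : 0 < R) (hx : 0 ≤ x) :
    sqrtGap (R ^ 2) x ≤ gapMajorant R x - gapMajorant R (x + 1) := by
  rcases lt_or_ge R x with h | h
  · have h1 : ¬ x ^ 2 ≤ R ^ 2 := by nlinarith
    simp [sqrtGap, gapMajorant, h1, not_le.2 h, not_le.2 (show R < x + 1 by linarith)]
  have h1 : x ^ 2 ≤ R ^ 2 := by nlinarith
  have h2 : R ^ 2 + 1 - x ^ 2 = (R ^ 2 - x ^ 2) + 1 := by ring
  rw [sqrtGap, if_pos h1, h2, gapMajorant, if_pos h, gapMajorant]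
  split_ifs with h3
  · have ht : 1 ≤ R - x := by linarith
    have hRt : 0 < R * (R - x) := by nlinarith
    have ha : R * (R - x) ≤ R ^ 2 - x ^ 2 := by nlinarith
    have hsR : 0 < Real.sqrt R := Real.sqrt_pos.2 hR
    have hst : 0 < Real.sqrt (R - x) := Real.sqrt_pos.2 (by linarith)
    calc Real.sqrt (R ^ 2 - x ^ 2 + 1) - Real.sqrt (R ^ 2 - x ^ 2)
        ≤ 1 / (2 * Real.sqrt (R ^ 2 - x ^ 2)) := sqrt_add_one_sub_sqrt_le (hRt.trans_le ha)
      _ ≤ 1 / (2 * Real.sqrt (R * (R - x))) := by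
          have := Real.sqrt_pos.2 hRt
          gcongr
      _ = 1 / (2 * Real.sqrt (R - x)) / Real.sqrt R := by
          rw [Real.sqrt_mul hR.le]
          field_simp
      _ ≤ (Real.sqrt (R - x) - Real.sqrt (R - x - 1)) / Real.sqrt R := by
          gcongr
          exact le_sqrt_sub_sqrt_sub_one ht
      _ = _ := by rw [sub_div, sub_sub R x 1]; ring
  · have : 0 ≤ Real.sqrt (R - x) / Real.sqrt R := by positivity
    linarith [sqrt_add_one_sub_sqrt_le_one (sub_nonneg.2 h1)]

lemma sum_range_sqrtGap_le {R d : ℝ} (hR : 0 < R) (hd : 0 ≤ d) (N : ℕ) :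
    ∑ m ∈ Finset.range N, sqrtGap (R ^ 2) (m + d) ≤ 2 := by
  have h : ∑ m ∈ Finset.range N, sqrtGap (R ^ 2) (m + d)
      ≤ gapMajorant R d - gapMajorant R (N + d) := by
    induction N with
    | zero => simp
    | succ N ih =>
      have := sqrtGap_le_gapMajorant_sub hR (show 0 ≤ (N : ℝ) + d by positivity)
      rw [Finset.sum_range_succ, Nat.cast_succ, add_right_comm]
      linarith
  linarith [gapMajorant_le_two (R := R) hd, gapMajorant_nonneg R (N + d)]

lemma tsum_sqrtGap_le {R e : ℝ} (hR : 0 < R) (he : e ∈ Set.Icc (0 : ℝ) 1) :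
    ∑' n : ℤ, sqrtGap (R ^ 2) (n - e) ≤ 4 := by
  have hs {d : ℝ} (hd : 0 ≤ d) : Summable fun m : ℕ => sqrtGap (R ^ 2) (m + d) :=
    summable_of_sum_range_le (fun _ => sqrtGap_nonneg _ _) (sum_range_sqrtGap_le hR hd)
  have hle {d : ℝ} (hd : 0 ≤ d) : ∑' m : ℕ, sqrtGap (R ^ 2) (m + d) ≤ 2 :=
    Real.tsum_le_of_sum_range_le (fun _ => sqrtGap_nonneg _ _) (sum_range_sqrtGap_le hR hd)
  have he' : 0 ≤ 1 - e := sub_nonneg.2 he.2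
  have hsum : HasSum (fun n : ℤ => sqrtGap (R ^ 2) (n + e))
      (∑' m : ℕ, sqrtGap (R ^ 2) (m + e) + ∑' m : ℕ, sqrtGap (R ^ 2) (m + (1 - e))) := by
    refine HasSum.of_nat_of_neg_add_one (by simpa using (hs he.1).hasSum) ?_
    convert (hs he').hasSum using 2 with m
    rw [← sqrtGap_neg]
    congr 1
    push_cast
    ring
  have hneg : ∑' n : ℤ, sqrtGap (R ^ 2) (n - e) = ∑' n : ℤ, sqrtGap (R ^ 2) (n + e) := by
    rw [← (Equiv.neg ℤ).tsum_eq]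
    refine tsum_congr fun n => ?_
    rw [← sqrtGap_neg]
    congr 1
    simp only [Equiv.neg_apply]
    push_cast
    ring
  rw [hneg, hsum.tsum_eq]
  linarith [hle he.1, hle he']


/-- There is an absolute constant `C > 0` such that for all real `c ≥ 1` and `e ∈ [0, 1)`,
`∑_{n ∈ ℤ, (n−e)² ≤ c} (√(c + 1 − (n−e)²) − √(c − (n−e)²)) ≤ C`. -/
theorem stmt_4 :
    ∃ C : ℝ, 0 < C ∧ ∀ c e : ℝ, 1 ≤ c → e ∈ Set.Ico (0 : ℝ) 1 →
      (∑' n : ℤ, if ((n : ℝ) - e) ^ 2 ≤ c then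
          (Real.sqrt (c + 1 - ((n : ℝ) - e) ^ 2) - Real.sqrt (c - ((n : ℝ) - e) ^ 2))
        else 0) ≤ C := by
  refine ⟨4, by norm_num, fun c e hc he => ?_⟩
  have h := tsum_sqrtGap_le (Real.sqrt_pos.2 (zero_lt_one.trans_le hc)) ⟨he.1, he.2.le⟩
  rwa [Real.sq_sqrt (zero_le_one.trans hc)] at h
end

section
/- There is an absolute constant C > 0 such that for all real numbers 1 ≤ μ ≤ λ, every unit vector a ∈ ℝ⁴, every τ ∈ ℝ, and every ξ ∈ ℝ³ × ℤ, the set B(τ, ξ) = {η ∈ ℝ³ × ℤ : |a·η| ≤ μ, |η| ≤ λ, and |τ + |η|² + |ξ − η|²| ≤ 1} has measure at most C μ λ, where ℝ³ × ℤ carries the product of the Lebesgue measure on ℝ³ and the counting measure on ℤ. -/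
open MeasureTheory

/-- Embedding of `ℝ³ × ℤ` into `ℝ⁴`. -/
noncomputable def embR3Z (p : (ℝ × ℝ × ℝ) × ℤ) : Fin 4 → ℝ :=
  ![p.1.1, p.1.2.1, p.1.2.2, (p.2 : ℝ)]

theorem EuclideanSpace.exists_orthonormalBasis_eq_norm_smul {n : ℕ} [NeZero n]
    (a : EuclideanSpace ℝ (Fin n)) :
    ∃ b : OrthonormalBasis (Fin n) ℝ (EuclideanSpace ℝ (Fin n)), a = ‖a‖ • b 0 := by
  by_cases ha : a = 0
  · exact ⟨EuclideanSpace.basisFun (Fin n) ℝ, by simp [ha]⟩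
  have hn : ‖a‖ ≠ 0 := norm_ne_zero_iff.mpr ha
  have ho : Orthonormal ℝ (({0} : Set (Fin n)).domRestrict fun _ => ‖a‖⁻¹ • a) := by
    refine ⟨fun i => ?_, fun i j hij => (hij (Subsingleton.elim i j)).elim⟩
    simp [norm_smul, hn]
  obtain ⟨b, hb⟩ := ho.exists_orthonormalBasis_extension_of_card_eq (by simp)
  refine ⟨b, ?_⟩
  rw [hb 0 rfl, smul_smul, mul_inv_cancel₀ hn, one_smul]

theorem exists_measurePreserving_rotation (a₁ a₂ a₃ : ℝ) :
    ∃ (Φ : ℝ × ℝ × ℝ → ℝ × EuclideanSpace ℝ (Fin 2)) (α : ℝ),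
      MeasurePreserving Φ volume volume ∧ α ^ 2 = a₁ ^ 2 + a₂ ^ 2 + a₃ ^ 2 ∧
      (∀ x, a₁ * x.1 + a₂ * x.2.1 + a₃ * x.2.2 = α * (Φ x).1) ∧
      (∀ x, x.1 ^ 2 + x.2.1 ^ 2 + x.2.2 ^ 2 = (Φ x).1 ^ 2 + ‖(Φ x).2‖ ^ 2) ∧
      ∀ x y, (x.1 - y.1) ^ 2 + (x.2.1 - y.2.1) ^ 2 + (x.2.2 - y.2.2) ^ 2 =
        ((Φ x).1 - (Φ y).1) ^ 2 + ‖(Φ x).2 - (Φ y).2‖ ^ 2 := by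
  obtain ⟨b, hb⟩ := EuclideanSpace.exists_orthonormalBasis_eq_norm_smul !₂[a₁, a₂, a₃]
  set a : EuclideanSpace ℝ (Fin 3) := !₂[a₁, a₂, a₃] with ha
  let e : ℝ × ℝ × ℝ → EuclideanSpace ℝ (Fin 3) := fun x => !₂[x.1, x.2.1, x.2.2]
  let f : EuclideanSpace ℝ (Fin 3) → ℝ × EuclideanSpace ℝ (Fin 2) :=
    fun y => (y 0, !₂[y 1, y 2])
  have hsplit := volume_preserving_piFinSuccAbove (fun _ : Fin 3 => ℝ) 0
  have he : MeasurePreserving e volume volume := by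
    have h := (PiLp.volume_preserving_toLp (Fin 3)).comp (hsplit.symm.comp
      ((MeasurePreserving.id (volume : Measure ℝ)).prod
        (volume_preserving_finTwoArrow ℝ).symm))
    have hee : WithLp.toLp 2 ∘ (MeasurableEquiv.piFinSuccAbove (fun _ : Fin 3 => ℝ) 0).symm ∘
        Prod.map id MeasurableEquiv.finTwoArrow.symm = e := by
      refine funext fun x => ?_
      ext i
      fin_cases i <;> rfl
    rw [hee] at h
    exact h
  have hf : MeasurePreserving f volume volume := by
    have h := ((MeasurePreserving.id (volume : Measure ℝ)).prod
      (PiLp.volume_preserving_toLp (Fin 2))).comp (hsplit.comp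
        (PiLp.volume_preserving_ofLp (Fin 3)))
    have hfe : Prod.map id (WithLp.toLp 2) ∘ MeasurableEquiv.piFinSuccAbove (fun _ => ℝ) 0 ∘
        WithLp.ofLp = f := by
      refine funext fun x => Prod.ext rfl ?_
      ext i
      fin_cases i <;> rfl
    rw [hfe] at h
    exact h
  have hfn : ∀ y, ‖y‖ ^ 2 = (f y).1 ^ 2 + ‖(f y).2‖ ^ 2 := fun y => by
    simp [f, EuclideanSpace.norm_sq_eq, Fin.sum_univ_three, add_assoc]
  have hfs : ∀ y z, f (y - z) = f y - f z := fun y z => by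
    ext i
    · rfl
    · fin_cases i <;> rfl
  have hen : ∀ x, ‖e x‖ ^ 2 = x.1 ^ 2 + x.2.1 ^ 2 + x.2.2 ^ 2 := fun x => by
    simp [e, EuclideanSpace.norm_sq_eq, Fin.sum_univ_three]
  have hes : ∀ x y, e (x - y) = e x - e y := fun x y => by
    ext i
    fin_cases i <;> rfl
  have hn : ∀ x, x.1 ^ 2 + x.2.1 ^ 2 + x.2.2 ^ 2 =
      (f (b.repr (e x))).1 ^ 2 + ‖(f (b.repr (e x))).2‖ ^ 2 := fun x => by
    rw [← hfn, b.repr.norm_map, hen]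
  refine ⟨fun x => f (b.repr (e x)), ‖a‖,
    hf.comp (b.measurePreserving_repr.comp he), ?_, fun x => ?_, hn, fun x y => ?_⟩
  · simp [ha, EuclideanSpace.norm_sq_eq, Fin.sum_univ_three]
  · have h : inner ℝ a (e x) = ‖a‖ * b.repr (e x) 0 := by
      conv_lhs => rw [hb]
      rw [real_inner_smul_left, b.repr_apply_apply]
    rw [← h]
    simp [ha, e, PiLp.inner_apply, Fin.sum_univ_three, mul_comm]
  · have h := hn (x - y)
    rwa [hes, map_sub, hfs] at h

theorem EuclideanSpace.volume_annulus_fin_two_le (w : EuclideanSpace ℝ (Fin 2)) (A : ℝ) :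
    volume {v : EuclideanSpace ℝ (Fin 2) | A ≤ ‖v - w‖ ^ 2 ∧ ‖v - w‖ ^ 2 ≤ A + 1} ≤
      ENNReal.ofReal Real.pi := by
  have hsub : {v : EuclideanSpace ℝ (Fin 2) | A ≤ ‖v - w‖ ^ 2 ∧ ‖v - w‖ ^ 2 ≤ A + 1} ⊆
      Metric.closedBall w √(A + 1) \ Metric.ball w √A := by
    rintro v ⟨h1, h2⟩
    simp only [Set.mem_sdiff, Metric.mem_closedBall, Metric.mem_ball, dist_eq_norm, not_lt]
    exact ⟨Real.le_sqrt_of_sq_le h2, (Real.sqrt_le_left (norm_nonneg _)).mpr h1⟩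
  have hpow : ∀ r : ℝ, ENNReal.ofReal √r ^ 2 = ENNReal.ofReal r := fun r => by
    rw [← ENNReal.ofReal_pow (Real.sqrt_nonneg _)]
    rcases le_total 0 r with h | h
    · rw [Real.sq_sqrt h]
    · simp [Real.sqrt_eq_zero_of_nonpos h, ENNReal.ofReal_of_nonpos h]
  refine (measure_mono hsub).trans ?_
  rw [measure_sdiff (Metric.ball_subset_closedBall.trans
      (Metric.closedBall_subset_closedBall (Real.sqrt_le_sqrt (by linarith))))
      measurableSet_ball.nullMeasurableSet measure_ball_lt_top.ne,
    EuclideanSpace.volume_closedBall_fin_two, EuclideanSpace.volume_ball_fin_two, hpow, hpow,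
    tsub_le_iff_right]
  have h1 : ENNReal.ofReal (A + 1) ≤ ENNReal.ofReal A + 1 :=
    ENNReal.ofReal_add_le.trans (by simp)
  calc _ ≤ (ENNReal.ofReal A + 1) * ENNReal.ofReal Real.pi := by gcongr
    _ = _ := by ring

theorem Int.count_setOf_abs_sub_le {r : ℝ} (hr : 0 ≤ r) (x : ℝ) :
    Measure.count {k : ℤ | |(k : ℝ) - x| ≤ r} ≤ ENNReal.ofReal (2 * r + 1) := by
  have hsub : {k : ℤ | |(k : ℝ) - x| ≤ r} ⊆ (Finset.Icc ⌈x - r⌉ ⌊x + r⌋ : Finset ℤ) := by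
    intro k hk
    have h1 := abs_le.mp (Set.mem_ofPred_eq ▸ hk)
    rw [Finset.coe_Icc, Set.mem_Icc, Int.ceil_le, Int.le_floor]
    constructor <;> linarith
  refine (measure_mono hsub).trans ?_
  rw [Measure.count_apply_finset, Int.card_Icc, ← ENNReal.ofReal_natCast]
  refine ENNReal.ofReal_le_ofReal ?_
  rw [← Int.cast_natCast, Int.toNat_eq_max]
  push_cast
  have h1 := Int.floor_le (x + r)
  have h2 := Int.le_ceil (x - r)
  exact max_le (by linarith) (by linarith)

theorem abs_sub_le_of_abs_mul_add_le {β c μ x : ℝ} (hβ : 1 / 2 ≤ |β|) (h : |β * x + c| ≤ μ) :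
    |x - -c / β| ≤ 2 * μ := by
  have hβ0 : β ≠ 0 := abs_pos.mp (by linarith)
  have h2 : β * x + c = β * (x - -c / β) := by field_simp; ring
  rw [h2, abs_mul] at h
  nlinarith [abs_nonneg (x - -c / β)]

theorem Int.count_setOf_abs_mul_add_le {β c μ : ℝ} (hβ : 1 / 2 ≤ |β|) (hμ : 0 ≤ μ) :
    Measure.count {k : ℤ | |β * k + c| ≤ μ} ≤ ENNReal.ofReal (4 * μ + 1) := by
  refine (measure_mono fun k hk => abs_sub_le_of_abs_mul_add_le hβ hk).trans
    ((Int.count_setOf_abs_sub_le (by linarith) (-c / β)).trans ?_)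
  exact ENNReal.ofReal_le_ofReal (by linarith)

theorem Real.volume_setOf_abs_mul_add_le {α c μ : ℝ} (hα : 1 / 2 ≤ |α|) :
    volume {t : ℝ | |α * t + c| ≤ μ} ≤ ENNReal.ofReal (4 * μ) := by
  have hsub : {t : ℝ | |α * t + c| ≤ μ} ⊆ Metric.closedBall (-c / α) (2 * μ) :=
    fun t ht => abs_sub_le_of_abs_mul_add_le hα ht
  refine (measure_mono hsub).trans ?_
  rw [Real.volume_closedBall]
  exact ENNReal.ofReal_le_ofReal (by linarith)

theorem volume_prod_count_strip_le {α β μ lam : ℝ} (hμ : 1 ≤ μ) (hlam : 1 ≤ lam)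
    (h : α ^ 2 + β ^ 2 = 1) :
    ((volume : Measure ℝ).prod (Measure.count : Measure ℤ))
      {p | |α * p.1 + β * p.2| ≤ μ ∧ |p.1| ≤ lam ∧ |(p.2 : ℝ)| ≤ lam} ≤
      ENNReal.ofReal (12 * μ * lam) := by
  have hmeas : MeasurableSet
      {p : ℝ × ℤ | |α * p.1 + β * p.2| ≤ μ ∧ |p.1| ≤ lam ∧ |(p.2 : ℝ)| ≤ lam} := by
    measurability
  by_cases hβ : 1 / 2 ≤ |β|
  · rw [Measure.prod_apply hmeas]
    calc _ ≤ ∫⁻ t, (Metric.closedBall (0 : ℝ) lam).indicator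
          (fun _ => ENNReal.ofReal (4 * μ + 1)) t := by
          refine lintegral_mono fun t => ?_
          by_cases ht : |t| ≤ lam
          · rw [Set.indicator_of_mem (by simpa using ht)]
            refine (measure_mono fun k hk => ?_).trans
              (Int.count_setOf_abs_mul_add_le (c := α * t) hβ (by linarith))
            simpa [add_comm] using hk.1
          · simp [ht]
      _ ≤ _ := by
          rw [lintegral_indicator_const measurableSet_closedBall, Real.volume_closedBall,
            ← ENNReal.ofReal_mul (by linarith)]
          exact ENNReal.ofReal_le_ofReal (by nlinarith)
  · have hα : 1 / 2 ≤ |α| := by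
      rw [← sq_abs α, ← sq_abs β] at h
      nlinarith [abs_nonneg α, abs_nonneg β]
    rw [Measure.prod_apply_symm hmeas]
    calc _ ≤ ∫⁻ k : ℤ, {k : ℤ | |(k : ℝ)| ≤ lam}.indicator
          (fun _ => ENNReal.ofReal (4 * μ)) k ∂Measure.count := by
          refine lintegral_mono fun k => ?_
          by_cases hk : |(k : ℝ)| ≤ lam
          · rw [Set.indicator_of_mem (by simpa using hk)]
            exact (measure_mono fun t ht => ht.1).trans
              (Real.volume_setOf_abs_mul_add_le (c := β * k) hα)
          · simp [hk]
      _ ≤ _ := by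
          rw [lintegral_indicator_const (MeasurableSet.of_discrete)]
          have hc : Measure.count {k : ℤ | |(k : ℝ)| ≤ lam} ≤ ENNReal.ofReal (2 * lam + 1) := by
            simpa using Int.count_setOf_abs_sub_le (by linarith : 0 ≤ lam) 0
          refine (mul_le_mul_right hc _).trans ?_
          rw [← ENNReal.ofReal_mul (by linarith)]
          exact ENNReal.ofReal_le_ofReal (by nlinarith)

/-- There is an absolute constant `C > 0` such that for all `1 ≤ μ ≤ λ`, every unit vector
`a ∈ ℝ⁴`, every `τ ∈ ℝ` and every `ξ ∈ ℝ³ × ℤ`, the set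
`B(τ,ξ) = {η ∈ ℝ³ × ℤ : |a·η| ≤ μ, |η| ≤ λ, |τ + |η|² + |ξ−η|²| ≤ 1}` has measure at most
`C μ λ` (Lebesgue measure on `ℝ³` × counting measure on `ℤ`). -/
theorem stmt_5 :
    ∃ C : ℝ, 0 < C ∧ ∀ (μ lam : ℝ) (a : Fin 4 → ℝ) (τ : ℝ) (ξ : (ℝ × ℝ × ℝ) × ℤ),
      1 ≤ μ → μ ≤ lam → (∑ i, a i ^ 2 = 1) →
      ((volume : Measure (ℝ × ℝ × ℝ)).prod (Measure.count : Measure ℤ))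
        {η : (ℝ × ℝ × ℝ) × ℤ |
          |∑ i, a i * embR3Z η i| ≤ μ ∧
          Real.sqrt (∑ i, embR3Z η i ^ 2) ≤ lam ∧
          |τ + (∑ i, embR3Z η i ^ 2) + ∑ i, (embR3Z ξ i - embR3Z η i) ^ 2| ≤ 1}
      ≤ ENNReal.ofReal (C * μ * lam) := by
  refine ⟨12 * Real.pi, by positivity, fun μ lam a τ ξ hμ hlam ha => ?_⟩
  obtain ⟨Φ, α, hΦ, hα, hlin, hsq, hdist⟩ := exists_measurePreserving_rotation (a 0) (a 1) (a 2)
  have hunit : α ^ 2 + a 3 ^ 2 = 1 := by rw [hα, ← ha, Fin.sum_univ_four]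
  set P : Set (ℝ × ℤ) := {p | |α * p.1 + a 3 * p.2| ≤ μ ∧ |p.1| ≤ lam ∧ |(p.2 : ℝ)| ≤ lam} with hP
  have hPm : MeasurableSet P := by
    rw [hP]
    measurability
  let s : ℝ := (Φ ξ.1).1
  let w : EuclideanSpace ℝ (Fin 2) := (Φ ξ.1).2
  let g : ℝ → ℤ → EuclideanSpace ℝ (Fin 2) → ℝ := fun t k v =>
    τ + (t ^ 2 + ‖v‖ ^ 2 + (k : ℝ) ^ 2) + ((s - t) ^ 2 + ‖w - v‖ ^ 2 + ((ξ.2 : ℝ) - k) ^ 2)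
  let T : Set ((ℝ × EuclideanSpace ℝ (Fin 2)) × ℤ) :=
    {q | (q.1.1, q.2) ∈ P ∧ |g q.1.1 q.2 q.1.2| ≤ 1}
  have hTm : MeasurableSet T := by
    refine MeasurableSet.inter ?_ ?_
    · exact (by fun_prop : Measurable fun q : (ℝ × EuclideanSpace ℝ (Fin 2)) × ℤ =>
        (q.1.1, q.2)) hPm
    · have : Measurable fun q : (ℝ × EuclideanSpace ℝ (Fin 2)) × ℤ => (q.2 : ℝ) :=
        (Measurable.of_discrete (f := fun k : ℤ => (k : ℝ))).comp measurable_snd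
      exact measurableSet_le (f := fun q : (ℝ × EuclideanSpace ℝ (Fin 2)) × ℤ =>
        |g q.1.1 q.2 q.1.2|) (by simp only [g]; fun_prop) measurable_const
  have hmp := hΦ.prod (MeasurePreserving.id (Measure.count : Measure ℤ))
  have hslice : ∀ t k, volume {v | |g t k v| ≤ 1} ≤ ENNReal.ofReal Real.pi := fun t k => by
    let A : ℝ := -(τ + t ^ 2 + (k : ℝ) ^ 2 + (s - t) ^ 2 + ((ξ.2 : ℝ) - k) ^ 2 +
      ‖w‖ ^ 2 / 2 + 1) / 2
    refine (measure_mono fun v hv => ?_).trans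
      (EuclideanSpace.volume_annulus_fin_two_le ((1 / 2 : ℝ) • w) A)
    have h1 : ‖v‖ ^ 2 + ‖w - v‖ ^ 2 = 2 * ‖v - (1 / 2 : ℝ) • w‖ ^ 2 + ‖w‖ ^ 2 / 2 := by
      rw [norm_sub_sq_real, norm_sub_sq_real, norm_smul, real_inner_smul_right,
        real_inner_comm, mul_pow]
      norm_num
      ring
    have hv' := abs_le.mp (Set.mem_ofPred_eq ▸ hv)
    simp only [g] at hv'
    simp only [Set.mem_ofPred_eq, A]
    constructor <;> linarith [hv'.1, hv'.2]
  calc _ ≤ ((volume : Measure (ℝ × ℝ × ℝ)).prod (Measure.count : Measure ℤ))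
        (Prod.map Φ id ⁻¹' T) := by
        refine measure_mono fun η hη => ?_
        simp only [Set.mem_ofPred_eq, Fin.sum_univ_four, embR3Z, Matrix.cons_val_zero,
          Matrix.cons_val_one, Matrix.cons_val] at hη
        obtain ⟨h1, h2, h3⟩ := hη
        rw [hlin] at h1
        rw [hsq] at h2 h3
        rw [hdist] at h3
        have hlam0 : 0 ≤ lam := by linarith
        rw [Real.sqrt_le_left hlam0] at h2
        refine ⟨⟨h1, ?_, ?_⟩, h3⟩
        · refine abs_le_of_sq_le_sq ?_ hlam0
          simp only [Prod.map]
          nlinarith [sq_nonneg ‖(Φ η.1).2‖, sq_nonneg (η.2 : ℝ)]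
        · refine abs_le_of_sq_le_sq ?_ hlam0
          simp only [Prod.map, id]
          nlinarith [sq_nonneg ‖(Φ η.1).2‖, sq_nonneg (Φ η.1).1]
    _ = ∫⁻ k : ℤ, ∫⁻ t : ℝ, volume {v | (t, k) ∈ P ∧ |g t k v| ≤ 1} ∂volume ∂Measure.count := by
        rw [hmp.measure_preimage hTm.nullMeasurableSet, Measure.prod_apply_symm hTm]
        refine lintegral_congr fun k => ?_
        rw [Measure.volume_eq_prod, Measure.prod_apply (measurable_prodMk_right hTm)]
        rfl
    _ ≤ ∫⁻ k : ℤ, ∫⁻ t : ℝ, ENNReal.ofReal Real.pi * P.indicator 1 (t, k)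
          ∂volume ∂Measure.count := by
        refine lintegral_mono fun k => lintegral_mono fun t => ?_
        by_cases h : (t, k) ∈ P
        · simpa [h] using hslice t k
        · simp [h]
    _ = ENNReal.ofReal Real.pi * ((volume : Measure ℝ).prod (Measure.count : Measure ℤ)) P := by
        have hm : Measurable (P.indicator (1 : ℝ × ℤ → ENNReal)) := measurable_one.indicator hPm
        rw [← lintegral_indicator_one hPm, ← lintegral_const_mul _ hm,
          lintegral_prod_symm' _ (hm.const_mul _)]
    _ ≤ ENNReal.ofReal Real.pi * ENNReal.ofReal (12 * μ * lam) := by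
        gcongr
        exact volume_prod_count_strip_le hμ (hμ.trans hlam) hunit
    _ = _ := by
        rw [← ENNReal.ofReal_mul Real.pi_nonneg]
        ring_nf
end

section
/- There is an absolute constant C > 0 such that for all real numbers a₁, a₄ with a₁² + a₄² = 1 and all real numbers 1 ≤ μ ≤ λ, the set {(x, n) ∈ ℝ × ℤ : |a₁ x + a₄ n| ≤ μ, |x| ≤ λ, |n| ≤ λ} has measure at most C μ λ, where ℝ × ℤ carries the product of the one-dimensional Lebesgue measure on ℝ and the counting measure on ℤ. -/
open MeasureTheory

theorem count_int_abs_sub_le (y r : ℝ) (hr : 0 ≤ r) :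
    (Measure.count : Measure ℤ) {n : ℤ | |(n : ℝ) - y| ≤ r} ≤ ENNReal.ofReal (2 * r + 1) := by
  have hset : {n : ℤ | |(n : ℝ) - y| ≤ r} = (Finset.Icc ⌈y - r⌉ ⌊y + r⌋ : Finset ℤ) := by
    ext n
    simp only [Set.mem_ofPred_eq, Finset.coe_Icc, Set.mem_Icc, Int.ceil_le, Int.le_floor, abs_le]
    constructor <;> rintro ⟨h₁, h₂⟩ <;> constructor <;> linarith
  rw [hset, Measure.count_apply_finset, Int.card_Icc, ← ENNReal.ofReal_natCast]
  apply ENNReal.ofReal_le_ofReal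
  have hcast : (((⌊y + r⌋ + 1 - ⌈y - r⌉).toNat : ℤ) : ℝ)
      = ((max (⌊y + r⌋ + 1 - ⌈y - r⌉) 0 : ℤ) : ℝ) := by
    rw [Int.toNat_eq_max]
  rw [← Int.cast_natCast, hcast, Int.cast_max]
  push_cast
  refine max_le ?_ (by linarith)
  linarith [Int.floor_le (y + r), Int.le_ceil (y - r)]

theorem abs_sub_le_of_abs_linear_le {a b x μ : ℝ} (ha : 1 / 2 ≤ |a|) (h : |a * x + b| ≤ μ) :
    |x - -b / a| ≤ 2 * μ := by
  have ha0 : a ≠ 0 := abs_pos.mp (by linarith)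
  have hfac : a * x + b = a * (x - -b / a) := by field_simp; ring
  rw [hfac, abs_mul] at h
  nlinarith [abs_nonneg (x - -b / a)]

theorem measurableSet_tube (a₁ a₄ μ lam : ℝ) :
    MeasurableSet
      {p : ℝ × ℤ | |a₁ * p.1 + a₄ * (p.2 : ℝ)| ≤ μ ∧ |p.1| ≤ lam ∧ |(p.2 : ℝ)| ≤ lam} := by
  have hcast : Measurable fun p : ℝ × ℤ => (p.2 : ℝ) :=
    (measurable_of_countable fun n : ℤ => (n : ℝ)).comp measurable_snd
  have h₀ : Measurable fun p : ℝ × ℤ => |a₁ * p.1 + a₄ * (p.2 : ℝ)| := by fun_prop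
  have h₁ : Measurable fun p : ℝ × ℤ => |p.1| := by fun_prop
  have h₂ : Measurable fun p : ℝ × ℤ => |(p.2 : ℝ)| := by fun_prop
  exact (measurableSet_le h₀ measurable_const).inter
    ((measurableSet_le h₁ measurable_const).inter (measurableSet_le h₂ measurable_const))

theorem MeasureTheory.lintegral_le_mul_of_le_on {α : Type*} [MeasurableSpace α] {ν : Measure α}
    {f : α → ENNReal} {s : Set α} (hs : MeasurableSet s) {c : ENNReal} (hf : ∀ x ∈ s, f x ≤ c)
    (hf0 : ∀ x ∉ s, f x = 0) : ∫⁻ x, f x ∂ν ≤ c * ν s := by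
  rw [← lintegral_indicator_const hs]
  refine lintegral_mono fun x => ?_
  by_cases hx : x ∈ s
  · simpa [hx] using hf x hx
  · simp [hx, hf0 x hx]

/-- There is an absolute constant `C > 0` such that for all reals `a₁, a₄` with `a₁² + a₄² = 1`
and all `1 ≤ μ ≤ λ`, the set `{(x, n) ∈ ℝ × ℤ : |a₁ x + a₄ n| ≤ μ, |x| ≤ λ, |n| ≤ λ}` has
measure at most `C μ λ` (Lebesgue × counting measure). -/
theorem stmt_6 :
    ∃ C : ℝ, 0 < C ∧ ∀ a₁ a₄ μ lam : ℝ, a₁ ^ 2 + a₄ ^ 2 = 1 → 1 ≤ μ → μ ≤ lam →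
      ((volume : Measure ℝ).prod (Measure.count : Measure ℤ))
        {p : ℝ × ℤ | |a₁ * p.1 + a₄ * (p.2 : ℝ)| ≤ μ ∧ |p.1| ≤ lam ∧ |(p.2 : ℝ)| ≤ lam}
      ≤ ENNReal.ofReal (C * μ * lam) := by
  refine ⟨12, by norm_num, fun a₁ a₄ μ lam ha hμ hlam => ?_⟩
  have hmeas := measurableSet_tube a₁ a₄ μ lam
  rcases le_or_gt (1 / 2) |a₁| with h₁ | h₁
  · rw [Measure.prod_apply_symm hmeas]
    have hcount := count_int_abs_sub_le 0 lam (by linarith)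
    simp only [sub_zero] at hcount
    refine (lintegral_le_mul_of_le_on (s := {n : ℤ | |(n : ℝ)| ≤ lam})
      (c := ENNReal.ofReal (4 * μ)) (Set.to_countable _).measurableSet
      (fun n _ => ?_) (fun n hn => ?_)).trans ?_
    · calc _ ≤ volume (Metric.closedBall (-(a₄ * n) / a₁) (2 * μ)) := by
            refine measure_mono fun x hx => ?_
            rw [Metric.mem_closedBall, Real.dist_eq]
            exact abs_sub_le_of_abs_linear_le h₁ hx.1
        _ = ENNReal.ofReal (4 * μ) := by rw [Real.volume_closedBall]; congr 1; ring
    · rw [← measure_empty (μ := (volume : Measure ℝ))]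
      congr 1
      exact Set.eq_empty_of_forall_notMem fun x hx => hn hx.2.2
    · refine (mul_le_mul_right hcount _).trans ?_
      rw [← ENNReal.ofReal_mul (by linarith)]
      exact ENNReal.ofReal_le_ofReal (by nlinarith)
  · have h₄ : 1 / 2 ≤ |a₄| := by
      by_contra! h
      nlinarith [sq_abs a₁, sq_abs a₄, abs_nonneg a₁, abs_nonneg a₄]
    rw [Measure.prod_apply hmeas]
    refine (lintegral_le_mul_of_le_on (s := Metric.closedBall (0 : ℝ) lam)
      (c := ENNReal.ofReal (2 * (2 * μ) + 1)) Metric.isClosed_closedBall.measurableSet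
      (fun x _ => ?_) (fun x hx => ?_)).trans ?_
    · refine (measure_mono fun n hn => ?_).trans
        (count_int_abs_sub_le (-(a₁ * x) / a₄) (2 * μ) (by linarith))
      exact abs_sub_le_of_abs_linear_le h₄ (by rw [add_comm]; exact hn.1)
    · rw [← measure_empty (μ := (Measure.count : Measure ℤ))]
      congr 1
      refine Set.eq_empty_of_forall_notMem fun n hn => hx ?_
      rw [Metric.mem_closedBall, Real.dist_eq, sub_zero]
      exact hn.2.1
    · rw [Real.volume_closedBall, ← ENNReal.ofReal_mul (by linarith)]
      exact ENNReal.ofReal_le_ofReal (by nlinarith)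
end

section
/- There is an absolute constant C > 0 such that for all real numbers 1 ≤ μ ≤ λ, every unit vector a ∈ ℝ⁴, every τ ∈ ℝ, and every ξ ∈ ℝ² × ℤ², the set B(τ, ξ) = {η ∈ ℝ² × ℤ² : |a·η| ≤ μ, |η| ≤ λ, and |τ + |η|² + |ξ − η|²| ≤ 1} has measure at most C μ^{1/3} λ^{5/3}, where ℝ² × ℤ² carries the product of the Lebesgue measure on ℝ² and the counting measure on ℤ². -/
open MeasureTheory

/-- Embedding of `ℝ² × ℤ²` into `ℝ⁴`. -/
noncomputable def embR2Z2 (p : (ℝ × ℝ) × (ℤ × ℤ)) : Fin 4 → ℝ :=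
  ![p.1.1, p.1.2, (p.2.1 : ℝ), (p.2.2 : ℝ)]

lemma volume_prod_le_of_slices {S : Set (ℝ × ℝ)} (hS : MeasurableSet S) {T : Set ℝ}
    {ℓ t : ENNReal} (hT : volume T ≤ t) (hST : ∀ p ∈ S, p.1 ∈ T)
    (hℓ : ∀ u, volume {v | (u, v) ∈ S} ≤ ℓ) : volume S ≤ ℓ * t := by
  rw [Measure.volume_eq_prod, Measure.prod_apply hS]
  calc ∫⁻ u, volume (Prod.mk u ⁻¹' S) ≤ ∫⁻ u, T.indicator (fun _ => ℓ) u := by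
        refine lintegral_mono fun u => ?_
        by_cases hu : u ∈ T
        · rw [Set.indicator_of_mem hu]
          exact hℓ u
        · have : Prod.mk u ⁻¹' S = ∅ := by
            ext v
            simpa using fun h => hu (hST _ h)
          simp [this]
    _ ≤ ℓ * volume T := lintegral_indicator_const_le T ℓ
    _ ≤ ℓ * t := by gcongr

lemma volume_prod_le_of_slices_symm {S : Set (ℝ × ℝ)} (hS : MeasurableSet S) {T : Set ℝ}
    {ℓ t : ENNReal} (hT : volume T ≤ t) (hST : ∀ p ∈ S, p.2 ∈ T)
    (hℓ : ∀ v, volume {u | (u, v) ∈ S} ≤ ℓ) : volume S ≤ ℓ * t := by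
  have h := volume_prod_le_of_slices (S := Prod.swap ⁻¹' S) (measurable_swap hS) hT
    (fun p hp => hST _ hp) hℓ
  rwa [Measure.volume_eq_prod, ← Measure.map_apply measurable_swap hS,
    Measure.prod_swap] at h

lemma volume_abs_mem_Icc_le {p q r : ℝ} (h : 2 * (q - p) ≤ r) (hr : 0 ≤ r) :
    volume {v : ℝ | p ≤ |v| ∧ |v| ≤ q} ≤ ENNReal.ofReal r := by
  have hsub : {v : ℝ | p ≤ |v| ∧ |v| ≤ q} ⊆ Set.Icc p q ∪ Set.Icc (-q) (-p) := by
    rintro v ⟨h1, h2⟩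
    rcases abs_cases v with ⟨h, -⟩ | ⟨h, -⟩
    · left; constructor <;> linarith
    · right; constructor <;> linarith
  calc volume {v : ℝ | p ≤ |v| ∧ |v| ≤ q}
      ≤ volume (Set.Icc p q) + volume (Set.Icc (-q) (-p)) :=
        (measure_mono hsub).trans (measure_union_le _ _)
    _ ≤ ENNReal.ofReal (r / 2) + ENNReal.ofReal (r / 2) := by
        rw [Real.volume_Icc, Real.volume_Icc]
        gcongr <;> linarith
    _ = ENNReal.ofReal r := by
        rw [← ENNReal.ofReal_add (by positivity) (by positivity), add_halves]

lemma volume_sq_mem_Icc_le (A : ℝ) {L : ℝ} (hL : 0 ≤ L) :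
    volume {v : ℝ | A ≤ v ^ 2 ∧ v ^ 2 ≤ A + L} ≤ ENNReal.ofReal (2 * √L) := by
  refine (measure_mono ?_).trans
    (volume_abs_mem_Icc_le (p := √A) (q := √(A + L)) (r := 2 * √L) ?_ (by positivity))
  · rintro v ⟨h1, h2⟩
    exact ⟨Real.sqrt_le_iff.2 ⟨abs_nonneg v, by rwa [sq_abs]⟩, Real.abs_le_sqrt h2⟩
  · have : √(A + L) ≤ √A + √L := by
      rw [Real.sqrt_le_iff]
      refine ⟨by positivity, ?_⟩
      rcases le_total 0 A with hA | hA
      · nlinarith [Real.sq_sqrt hA, Real.sq_sqrt hL, Real.sqrt_nonneg A, Real.sqrt_nonneg L,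
          mul_nonneg (Real.sqrt_nonneg A) (Real.sqrt_nonneg L)]
      · rw [Real.sqrt_eq_zero_of_nonpos hA]
        nlinarith [Real.sq_sqrt hL]
    linarith

lemma volume_sq_mem_Icc_le_of_le_abs (A : ℝ) {L κ : ℝ} (hL : 0 ≤ L) (hκ : 0 < κ) :
    volume {v : ℝ | κ ≤ |v| ∧ A ≤ v ^ 2 ∧ v ^ 2 ≤ A + L} ≤ ENNReal.ofReal (L / κ) := by
  refine (measure_mono ?_).trans
    (volume_abs_mem_Icc_le (p := max κ √A) (q := √(A + L)) (r := L / κ) ?_ (by positivity))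
  · rintro v ⟨h0, h1, h2⟩
    exact ⟨max_le h0 (Real.sqrt_le_iff.2 ⟨abs_nonneg v, by rwa [sq_abs]⟩), Real.abs_le_sqrt h2⟩
  · rw [le_div_iff₀ hκ]
    set p := max κ √A
    set q := √(A + L)
    have hp : κ ≤ p := le_max_left _ _
    have hA : A ≤ p ^ 2 := by
      rcases le_total 0 A with hA | hA
      · calc A = √A ^ 2 := (Real.sq_sqrt hA).symm
          _ ≤ p ^ 2 := by gcongr; exact le_max_right _ _
      · nlinarith [sq_nonneg p]
    rcases le_total q p with h | h
    · nlinarith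
    · have hq : q ^ 2 = A + L := Real.sq_sqrt (by
        by_contra! hn
        have : q = 0 := Real.sqrt_eq_zero_of_nonpos hn.le
        linarith)
      nlinarith

lemma volume_annulus_inter_strip_le (c : ℝ) {w ρ : ℝ} (hw : 0 < w) (hρ : 1 ≤ ρ)
    (hwρ : 1 ≤ w * ρ) :
    volume {p : ℝ × ℝ | |p.1 - c| ≤ w ∧ |p.1 ^ 2 + p.2 ^ 2 - ρ ^ 2| ≤ 1 / 2}
      ≤ ENNReal.ofReal (26 * (√w / √ρ)) := by
  have hρ0 : 0 < ρ := by linarith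
  set S : Set (ℝ × ℝ) := {p | |p.1 - c| ≤ w ∧ |p.1 ^ 2 + p.2 ^ 2 - ρ ^ 2| ≤ 1 / 2}
  have hSm : MeasurableSet S := by
    apply IsClosed.measurableSet
    exact (isClosed_le (f := fun p : ℝ × ℝ => |p.1 - c|) (by fun_prop) (by fun_prop)).inter
      (isClosed_le (f := fun p : ℝ × ℝ => |p.1 ^ 2 + p.2 ^ 2 - ρ ^ 2|) (by fun_prop) (by fun_prop))
  have hbound : ∀ p ∈ S, |p.1| ≤ 2 * ρ := by
    rintro p ⟨-, h⟩
    rw [abs_le] at h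
    apply abs_le_of_sq_le_sq _ (by positivity)
    nlinarith [sq_nonneg p.2]
  set S₁ : Set (ℝ × ℝ) := S ∩ {p | ρ / 2 ≤ |p.2|}
  set S₂ : Set (ℝ × ℝ) := S ∩ {p | ρ / 2 ≤ |p.1|}
  have hS₁m : MeasurableSet S₁ :=
    hSm.inter (isClosed_le (by fun_prop) (by fun_prop)).measurableSet
  have hS₂m : MeasurableSet S₂ :=
    hSm.inter (isClosed_le (by fun_prop) (by fun_prop)).measurableSet
  have hcover : S ⊆ S₁ ∪ S₂ := by
    intro p hp
    by_contra hn
    have h1 : |p.2| < ρ / 2 := by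
      by_contra! h; exact hn (Or.inl ⟨hp, h⟩)
    have h2 : |p.1| < ρ / 2 := by
      by_contra! h; exact hn (Or.inr ⟨hp, h⟩)
    have h3 := (abs_le.1 hp.2).1
    have h4 := sq_lt_sq' (by linarith [abs_nonneg p.2]) h1
    have h5 := sq_lt_sq' (by linarith [abs_nonneg p.1]) h2
    rw [sq_abs] at h4 h5
    nlinarith
  have hsq : √(w * ρ) ^ 2 = w * ρ := Real.sq_sqrt (by positivity)
  have hvol₁ : volume S₁ ≤ ENNReal.ofReal (2 / ρ) * ENNReal.ofReal (4 * √(w * ρ)) := by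
    refine volume_prod_le_of_slices hS₁m (T := Set.Icc (c - w) (c + w) ∩ Set.Icc (-(2 * ρ)) (2 * ρ))
      ?_ ?_ ?_
    · rcases le_total w ρ with h | h
      · refine (measure_mono Set.inter_subset_left).trans ?_
        rw [Real.volume_Icc]
        apply ENNReal.ofReal_le_ofReal
        have : w ≤ √(w * ρ) := Real.le_sqrt_of_sq_le (by nlinarith)
        linarith
      · refine (measure_mono Set.inter_subset_right).trans ?_
        rw [Real.volume_Icc]
        apply ENNReal.ofReal_le_ofReal
        have : ρ ≤ √(w * ρ) := Real.le_sqrt_of_sq_le (by nlinarith)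
        linarith
    · rintro p ⟨hp, -⟩
      have h1 := abs_le.1 hp.1
      exact ⟨⟨by linarith, by linarith⟩, abs_le.1 (hbound p hp)⟩
    · intro u
      refine (measure_mono ?_).trans ((volume_sq_mem_Icc_le_of_le_abs (ρ ^ 2 - u ^ 2 - 1 / 2)
        (L := 1) (κ := ρ / 2) (by norm_num) (by positivity)).trans_eq (by congr 1; field_simp))
      rintro v ⟨⟨-, h⟩, h'⟩
      have h1 := abs_le.1 h
      dsimp only at h1
      exact ⟨h', by linarith, by linarith⟩
  have hvol₂ : volume S₂ ≤ ENNReal.ofReal (2 / ρ) * ENNReal.ofReal (9 * √(w * ρ)) := by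
    rcases S₂.eq_empty_or_nonempty with he | ⟨p₀, hp₀⟩
    · simp [he]
    refine volume_prod_le_of_slices_symm hS₂m
      (T := {v | p₀.2 ^ 2 - 9 * (w * ρ) ≤ v ^ 2 ∧ v ^ 2 ≤ p₀.2 ^ 2 - 9 * (w * ρ) + 18 * (w * ρ)})
      ?_ ?_ ?_
    · refine (volume_sq_mem_Icc_le _ (by positivity)).trans (ENNReal.ofReal_le_ofReal ?_)
      have : √(18 * (w * ρ)) ≤ 9 / 2 * √(w * ρ) := by
        rw [Real.sqrt_le_iff]
        exact ⟨by positivity, by nlinarith⟩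
      linarith
    · rintro p ⟨hp, -⟩
      have hu : |p.1 ^ 2 - p₀.1 ^ 2| ≤ 8 * (w * ρ) := by
        have h1 : |p.1 - p₀.1| ≤ 2 * w := by
          have := abs_sub_le p.1 c p₀.1
          have h2 := hp.1
          have h3 := hp₀.1.1
          rw [abs_sub_comm] at h3
          linarith
        have h2 : |p.1 + p₀.1| ≤ 4 * ρ := by
          have := abs_add_le p.1 p₀.1
          linarith [hbound p hp, hbound p₀ hp₀.1]
        calc |p.1 ^ 2 - p₀.1 ^ 2| = |p.1 - p₀.1| * |p.1 + p₀.1| := by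
              rw [← abs_mul]; congr 1; ring
          _ ≤ 2 * w * (4 * ρ) := by gcongr
          _ = 8 * (w * ρ) := by ring
      have h1 := abs_le.1 hp.2
      have h2 := abs_le.1 hp₀.1.2
      have h3 := abs_le.1 hu
      constructor <;> linarith
    · intro v
      refine (measure_mono ?_).trans ((volume_sq_mem_Icc_le_of_le_abs (ρ ^ 2 - v ^ 2 - 1 / 2)
        (L := 1) (κ := ρ / 2) (by norm_num) (by positivity)).trans_eq (by congr 1; field_simp))
      rintro u ⟨⟨-, h⟩, h'⟩
      have h1 := abs_le.1 h
      dsimp only at h1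
      exact ⟨h', by linarith, by linarith⟩
  calc volume S ≤ volume S₁ + volume S₂ := (measure_mono hcover).trans (measure_union_le _ _)
    _ ≤ _ := add_le_add hvol₁ hvol₂
    _ = ENNReal.ofReal (26 * (√w / √ρ)) := by
      rw [← ENNReal.ofReal_mul (by positivity), ← ENNReal.ofReal_mul (by positivity),
        ← ENNReal.ofReal_add (by positivity) (by positivity)]
      congr 1
      rw [Real.sqrt_mul hw.le]
      have : √ρ ^ 2 = ρ := Real.sq_sqrt hρ0.le
      have h0 : 0 < √ρ := Real.sqrt_pos.2 hρ0
      field_simp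
      rw [this]
      ring

lemma volume_preimage_rotation {e₁ e₂ : ℝ} (he : e₁ ^ 2 + e₂ ^ 2 = 1) (x₀ y₀ : ℝ)
    (S : Set (ℝ × ℝ)) :
    volume {p : ℝ × ℝ | (e₁ * (p.1 - x₀) + e₂ * (p.2 - y₀),
      -e₂ * (p.1 - x₀) + e₁ * (p.2 - y₀)) ∈ S} = volume S := by
  set f : ℝ × ℝ →ₗ[ℝ] ℝ × ℝ := Matrix.toLin (Module.Basis.finTwoProd ℝ)
    (Module.Basis.finTwoProd ℝ) !![e₁, e₂; -e₂, e₁]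
  have hdet : LinearMap.det f = 1 := by
    rw [LinearMap.det_toLin, Matrix.det_fin_two_of]
    linarith
  have h1 : {p : ℝ × ℝ | (e₁ * (p.1 - x₀) + e₂ * (p.2 - y₀),
      -e₂ * (p.1 - x₀) + e₁ * (p.2 - y₀)) ∈ S} = (fun p => p + (-x₀, -y₀)) ⁻¹' (f ⁻¹' S) := by
    ext p
    simp [f, Matrix.toLin_finTwoProd_apply, sub_eq_add_neg]
  rw [h1, measure_preimage_add_right,
    Measure.addHaar_preimage_linearMap _ (by rw [hdet]; exact one_ne_zero), hdet]
  simp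

lemma volume_slice_le_s7 {e₁ e₂ : ℝ} (he : e₁ ^ 2 + e₂ ^ 2 = 1) (x₀ y₀ b : ℝ) {w E M : ℝ}
    (hw : 1 ≤ w) (hM : 1 ≤ M) (hE : -(1 / 2) ≤ E → M ^ 2 ≤ max 1 E) :
    volume {p : ℝ × ℝ | |e₁ * p.1 + e₂ * p.2 + b| ≤ w ∧
      |(p.1 - x₀) ^ 2 + (p.2 - y₀) ^ 2 - E| ≤ 1 / 2} ≤ ENNReal.ofReal (26 * (√w / √M)) := by
  rcases lt_or_ge E 1 with h1 | h1
  · rcases lt_or_ge E (-(1 / 2)) with h2 | h2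
    · refine (measure_mono (t := ∅) ?_).trans (by simp)
      rintro p ⟨-, hp⟩
      have := (abs_le.1 hp).2
      nlinarith [sq_nonneg (p.1 - x₀), sq_nonneg (p.2 - y₀)]
    · have hM1 : M = 1 := by
        have := hE h2
        rw [max_eq_left h1.le] at this
        nlinarith
      refine (measure_mono (t := Set.Icc (x₀ - 2) (x₀ + 2) ×ˢ Set.Icc (y₀ - 2) (y₀ + 2)) ?_).trans ?_
      · rintro p ⟨-, hp⟩
        have := (abs_le.1 hp).2
        have hx := abs_le_of_sq_le_sq' (a := p.1 - x₀) (b := 2)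
          (by nlinarith [sq_nonneg (p.2 - y₀)]) (by norm_num)
        have hy := abs_le_of_sq_le_sq' (a := p.2 - y₀) (b := 2)
          (by nlinarith [sq_nonneg (p.1 - x₀)]) (by norm_num)
        exact ⟨⟨by linarith, by linarith⟩, ⟨by linarith, by linarith⟩⟩
      · rw [Measure.volume_eq_prod, Measure.prod_prod, Real.volume_Icc, Real.volume_Icc,
          ← ENNReal.ofReal_mul (by norm_num)]
        apply ENNReal.ofReal_le_ofReal
        have : 1 ≤ √w := Real.one_le_sqrt.2 hw
        rw [hM1, Real.sqrt_one, div_one]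
        nlinarith
  · have hE0 : √E ^ 2 = E := Real.sq_sqrt (by linarith)
    have hρ : 1 ≤ √E := Real.one_le_sqrt.2 h1
    have hMρ : M ≤ √E := Real.le_sqrt_of_sq_le (by
      simpa [max_eq_right h1] using hE (by linarith))
    have h := volume_annulus_inter_strip_le (-(e₁ * x₀ + e₂ * y₀ + b)) (w := w) (ρ := √E)
      (by linarith) hρ (by nlinarith)
    rw [← volume_preimage_rotation he x₀ y₀] at h
    refine (measure_mono ?_).trans (h.trans (ENNReal.ofReal_le_ofReal (by gcongr)))
    rintro p ⟨hp1, hp2⟩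
    refine ⟨?_, ?_⟩
    · convert hp1 using 2
      dsimp only
      ring
    · rw [hE0]
      convert hp2 using 2
      dsimp only
      linear_combination ((p.1 - x₀) ^ 2 + (p.2 - y₀) ^ 2) * he

lemma volume_annulus_le (x₀ y₀ E : ℝ) :
    volume {p : ℝ × ℝ | |(p.1 - x₀) ^ 2 + (p.2 - y₀) ^ 2 - E| ≤ 1 / 2}
      ≤ ENNReal.ofReal 40 := by
  set M := √(max 1 E)
  have hM : 1 ≤ M := Real.one_le_sqrt.2 (le_max_left _ _)
  have hM2 : M ^ 2 = max 1 E := Real.sq_sqrt (by positivity)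
  refine (measure_mono ?_).trans ((volume_slice_le_s7 (e₁ := 1) (e₂ := 0) (by norm_num) x₀ y₀ (-x₀)
    (w := 2 * M) (E := E) (M := M) (by linarith) hM (fun _ => hM2.le)).trans
    (ENNReal.ofReal_le_ofReal ?_))
  · intro p hp
    refine ⟨?_, hp⟩
    apply abs_le_of_sq_le_sq _ (by positivity)
    have := (abs_le.1 (Set.mem_ofPred.1 hp)).2
    nlinarith [sq_nonneg (p.2 - y₀), le_max_right 1 E]
  · have h0 : 0 < √M := Real.sqrt_pos.2 (by linarith)
    rw [Real.sqrt_mul (by norm_num), mul_div_assoc, div_self h0.ne', mul_one]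
    nlinarith [Real.sq_sqrt (show (0 : ℝ) ≤ 2 by norm_num), Real.sqrt_nonneg 2]

lemma card_filter_abs_le {α : ℝ} (hα : 1 / 2 ≤ |α|) (b : ℝ) {h : ℝ} (hh : 0 ≤ h) (K : Finset ℤ) :
    ((K.filter fun n : ℤ => |α * n + b| ≤ h).card : ℝ) ≤ 4 * h + 1 := by
  have hα0 : α ≠ 0 := by rintro rfl; norm_num at hα
  have hsub : (K.filter fun n : ℤ => |α * n + b| ≤ h) ⊆
      Finset.Icc ⌈-b / α - 2 * h⌉ ⌊-b / α + 2 * h⌋ := by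
    intro n hn
    have h1 : |α * n + b| ≤ h := (Finset.mem_filter.1 hn).2
    have h2 : |(n : ℝ) - -b / α| ≤ 2 * h := by
      have : α * n + b = α * (n - -b / α) := by field_simp; ring
      rw [this, abs_mul] at h1
      nlinarith [abs_nonneg ((n : ℝ) - -b / α)]
    have h3 := abs_le.1 h2
    rw [Finset.mem_Icc, Int.ceil_le, Int.le_floor]
    constructor <;> linarith
  have h1 := Finset.card_le_card hsub
  rw [Int.card_Icc] at h1
  have h2 : (((⌊-b / α + 2 * h⌋ + 1 - ⌈-b / α - 2 * h⌉).toNat : ℤ) : ℝ) ≤ 4 * h + 1 := by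
    rw [Int.toNat_eq_max, Int.cast_max]
    push_cast
    apply max_le _ (by positivity)
    linarith [Int.floor_le (-b / α + 2 * h), Int.le_ceil (-b / α - 2 * h)]
  push_cast at h2
  exact (Nat.cast_le.2 h1).trans h2

/-- The odd extension of the square root, an antiderivative of `1 / (2 √|t|)`. -/
noncomputable def oddSqrt (t : ℝ) : ℝ := √t - √(-t)

lemma oddSqrt_sub_le {s t : ℝ} (h : s ≤ t) : oddSqrt t - oddSqrt s ≤ 2 * √(t - s) := by
  have key : ∀ x y : ℝ, x ≤ y → √y ≤ √x + √(y - x) := fun x y hxy => by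
    rcases le_total 0 x with hx | hx
    · rw [Real.sqrt_le_iff]
      refine ⟨by positivity, ?_⟩
      nlinarith [Real.sq_sqrt hx, Real.sq_sqrt (sub_nonneg.2 hxy),
        mul_nonneg (Real.sqrt_nonneg x) (Real.sqrt_nonneg (y - x))]
    · rw [Real.sqrt_eq_zero_of_nonpos hx, zero_add]
      exact Real.sqrt_le_sqrt (by linarith)
  have h1 := key s t h
  have h2 := key (-t) (-s) (by linarith)
  rw [show -s - -t = t - s by ring] at h2
  unfold oddSqrt
  linarith

lemma inv_sqrt_max_le (t : ℝ) : 1 / √(max 1 |t|) ≤ 4 * (oddSqrt (t + 1) - oddSqrt t) := by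
  have hm : 0 < √(max 1 |t|) := Real.sqrt_pos.2 (by positivity)
  have hm1 : 1 ≤ √(max 1 |t|) := Real.one_le_sqrt.2 (le_max_left _ _)
  have hms : √(max 1 |t|) ^ 2 = max 1 |t| := Real.sq_sqrt (by positivity)
  have hml := le_max_left 1 |t|
  have hmr := le_max_right 1 |t|
  set r := √(max 1 |t|)
  unfold oddSqrt
  rw [div_le_iff₀ hm]
  have gap : ∀ x : ℝ, 0 ≤ x → x + 1 ≤ 4 * r ^ 2 → 1 ≤ 4 * (√(x + 1) - √x) * r := by
    intro x hx hxr
    have h1 := Real.sq_sqrt hx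
    have h2 := Real.sq_sqrt (show 0 ≤ x + 1 by linarith)
    have h3 : √(x + 1) ≤ 2 * r := Real.sqrt_le_iff.2 ⟨by positivity, by linarith⟩
    have h4 : √x ≤ √(x + 1) := Real.sqrt_le_sqrt (by linarith)
    nlinarith [Real.sqrt_nonneg x]
  rcases le_or_gt 0 t with h | h
  · rw [Real.sqrt_eq_zero_of_nonpos (show -t ≤ 0 by linarith),
      Real.sqrt_eq_zero_of_nonpos (show -(t + 1) ≤ 0 by linarith), sub_zero, sub_zero]
    refine gap t h ?_
    rw [abs_of_nonneg h] at *
    linarith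
  rw [abs_of_neg h] at *
  rcases le_or_gt t (-1) with h' | h'
  · rw [Real.sqrt_eq_zero_of_nonpos h.le,
      Real.sqrt_eq_zero_of_nonpos (show t + 1 ≤ 0 by linarith)]
    have := gap (-(t + 1)) (by linarith) (by linarith)
    rw [show -(t + 1) + 1 = -t by ring] at this
    linarith
  · rw [Real.sqrt_eq_zero_of_nonpos h.le,
      Real.sqrt_eq_zero_of_nonpos (show -(t + 1) ≤ 0 by linarith)]
    have h1 := Real.sq_sqrt (show 0 ≤ t + 1 by linarith)
    have h2 := Real.sq_sqrt (show 0 ≤ -t by linarith)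
    have h3 : 1 ≤ √(t + 1) + √(-t) := by
      nlinarith [Real.sqrt_nonneg (t + 1), Real.sqrt_nonneg (-t)]
    nlinarith

lemma sum_Ico_int_telescope (f : ℤ → ℝ) (a : ℤ) (k : ℕ) :
    ∑ n ∈ Finset.Ico a (a + k), (f (n + 1) - f n) = f (a + k) - f a := by
  induction k with
  | zero => simp
  | succ k ih =>
    have : Finset.Ico a (a + (k + 1 : ℕ)) = insert (a + k : ℤ) (Finset.Ico a (a + k)) := by
      ext n; simp; omega
    rw [this, Finset.sum_insert (by simp), ih]
    push_cast
    rw [add_assoc a]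
    ring

lemma sum_inv_sqrt_le (x : ℝ) (a : ℤ) (k : ℕ) :
    ∑ n ∈ Finset.Ico a (a + k), 1 / √(max 1 |(n : ℝ) - x|) ≤ 8 * √k := by
  calc ∑ n ∈ Finset.Ico a (a + k), 1 / √(max 1 |(n : ℝ) - x|)
      ≤ ∑ n ∈ Finset.Ico a (a + k),
          (4 * oddSqrt (((n + 1 : ℤ) : ℝ) - x) - 4 * oddSqrt ((n : ℝ) - x)) := by
        refine Finset.sum_le_sum fun n _ => (inv_sqrt_max_le _).trans_eq ?_
        rw [mul_sub]
        push_cast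
        ring_nf
    _ = 4 * (oddSqrt (((a + k : ℤ) : ℝ) - x) - oddSqrt ((a : ℝ) - x)) := by
        rw [sum_Ico_int_telescope (fun n => 4 * oddSqrt ((n : ℝ) - x)), mul_sub]
    _ ≤ 4 * (2 * √k) := by
        gcongr
        refine (oddSqrt_sub_le (by push_cast; linarith [k.cast_nonneg (α := ℝ)])).trans_eq ?_
        push_cast
        ring_nf
    _ = 8 * √k := by ring

lemma prod_count_le_sum {X : Type*} [MeasureSpace X] [SFinite (volume : Measure X)]
    {S : Set (X × (ℤ × ℤ))} {K : Finset (ℤ × ℤ)} {g : ℤ × ℤ → ℝ} (hg : ∀ k, 0 ≤ g k)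
    (hK : ∀ p ∈ S, p.2 ∈ K)
    (hS : ∀ k ∈ K, volume {x | (x, k) ∈ S} ≤ ENNReal.ofReal (g k)) :
    ((volume : Measure X).prod (Measure.count : Measure (ℤ × ℤ))) S
      ≤ ENNReal.ofReal (∑ k ∈ K, g k) := by
  have hsub : S ⊆ ⋃ k ∈ K, {x | (x, k) ∈ S} ×ˢ {k} := by
    rintro ⟨x, k⟩ h
    exact Set.mem_iUnion₂.2 ⟨k, hK _ h, h, rfl⟩
  rw [ENNReal.ofReal_sum_of_nonneg fun k _ => hg k]
  refine (measure_mono hsub).trans ((measure_biUnion_finset_le _ _).trans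
    (Finset.sum_le_sum fun k hk => ?_))
  rw [Measure.prod_prod, Measure.count_singleton, mul_one]
  exact hS k hk

lemma card_filter_product_le {a₃ a₄ s h : ℝ} (hs : 0 ≤ s) (ha : s ^ 2 + a₃ ^ 2 + a₄ ^ 2 = 1)
    (hh : 0 ≤ h) (I : Finset ℤ) (hI : 2 * s * (I.card - 1) ≤ 4 * h) :
    (((I ×ˢ I).filter fun k : ℤ × ℤ => |a₃ * k.1 + a₄ * k.2| ≤ h).card : ℝ)
      ≤ I.card * (4 * h + 1) := by
  rcases le_or_gt (1 / 2) |a₄| with h4 | h4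
  · rw [Finset.card_filter, Finset.sum_product]
    push_cast
    rw [← nsmul_eq_mul]
    refine Finset.sum_le_card_nsmul _ _ _ fun m _ => ?_
    have := card_filter_abs_le h4 (a₃ * m) hh I
    rw [Finset.card_filter] at this
    push_cast at this
    simpa only [add_comm (a₃ * (m : ℝ))] using this
  rcases le_or_gt (1 / 2) |a₃| with h3 | h3
  · rw [Finset.card_filter, Finset.sum_product_right]
    push_cast
    rw [← nsmul_eq_mul]
    refine Finset.sum_le_card_nsmul _ _ _ fun n _ => ?_
    have := card_filter_abs_le h3 (a₄ * n) hh I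
    rw [Finset.card_filter] at this
    push_cast at this
    exact this
  · have h5 : 1 / 2 ≤ s := by
      by_contra! hlt
      have e4 := sq_lt_sq' (by linarith [abs_nonneg a₄]) h4
      have e3 := sq_lt_sq' (by linarith [abs_nonneg a₃]) h3
      rw [sq_abs] at e3 e4
      nlinarith
    have hcard := Finset.card_filter_le (I ×ˢ I) fun k : ℤ × ℤ => |a₃ * k.1 + a₄ * k.2| ≤ h
    rw [Finset.card_product] at hcard
    have hcard' := (Nat.cast_le (α := ℝ)).2 hcard
    push_cast at hcard'
    refine hcard'.trans ?_
    gcongr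
    rcases le_total (I.card : ℝ) 1 with h1 | h1
    · linarith
    · nlinarith

lemma sq_max_one_abs_sub_sqrt_le {D t : ℝ} (h : -(1 / 2) ≤ D - t ^ 2) :
    (max 1 |(|t| - √D)|) ^ 2 ≤ max 1 (D - t ^ 2) := by
  have ht := sq_abs t
  have ht0 := abs_nonneg t
  have key : (|t| - √D) ^ 2 ≤ max 1 (D - t ^ 2) := by
    rcases le_total 0 D with hD | hD
    · have h1 := Real.sq_sqrt hD
      have h2 := Real.sqrt_nonneg D
      rcases le_total |t| √D with h3 | h3
      · exact le_max_of_le_right (by nlinarith)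
      · exact le_max_of_le_left (by nlinarith)
    · rw [Real.sqrt_eq_zero_of_nonpos hD]
      exact le_max_of_le_left (by nlinarith)
  rcases max_choice 1 |(|t| - √D)| with h1 | h1
  · rw [h1, one_pow]
    exact le_max_left _ _
  · rwa [h1, sq_abs]

lemma sum_inv_sqrt_max_abs_abs_sub_le (c d : ℝ) (a : ℤ) (k : ℕ) :
    ∑ n ∈ Finset.Ico a (a + k), 1 / √(max 1 |(|(n : ℝ) - c| - d)|) ≤ 16 * √k := by
  calc ∑ n ∈ Finset.Ico a (a + k), 1 / √(max 1 |(|(n : ℝ) - c| - d)|)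
      ≤ ∑ n ∈ Finset.Ico a (a + k),
        (1 / √(max 1 |(n : ℝ) - (c + d)|) + 1 / √(max 1 |(n : ℝ) - (c - d)|)) := by
        refine Finset.sum_le_sum fun n _ => ?_
        rcases abs_choice ((n : ℝ) - c) with h | h
        · rw [h, sub_sub]
          exact le_add_of_nonneg_right (by positivity)
        · rw [h, show -((n : ℝ) - c) - d = -(n - (c - d)) by ring, abs_neg]
          exact le_add_of_nonneg_left (by positivity)
    _ ≤ 8 * √k + 8 * √k := by
        rw [Finset.sum_add_distrib]
        exact add_le_add (sum_inv_sqrt_le _ _ _) (sum_inv_sqrt_le _ _ _)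
    _ = 16 * √k := by ring

lemma card_bound_arith {p q s k : ℝ} (hp : 1 ≤ p) (hpq : p ≤ q) (hs0 : 0 ≤ s)
    (hs : s * q ≤ p) (hk : k ≤ 3 * q ^ 3) :
    k * (4 * (p ^ 3 + s * q ^ 3) + 1) * 40 ≤ 2500 * (p * q ^ 5) := by
  have h0 : 0 < q := by linarith
  have h1 : p ^ 3 ≤ p * q ^ 2 := by
    rw [pow_succ' p 2]; gcongr
  have h2 : s * q ^ 3 ≤ p * q ^ 2 := by
    calc s * q ^ 3 = (s * q) * q ^ 2 := by ring
      _ ≤ p * q ^ 2 := by gcongr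
  have h3 : 1 ≤ p * q ^ 2 := one_le_mul_of_one_le_of_one_le hp (one_le_pow₀ (hp.trans hpq))
  calc k * (4 * (p ^ 3 + s * q ^ 3) + 1) * 40
      ≤ 3 * q ^ 3 * (4 * (p * q ^ 2 + p * q ^ 2) + p * q ^ 2) * 40 := by gcongr
    _ = 1080 * (p * q ^ 5) := by ring
    _ ≤ _ := by gcongr; norm_num

lemma sqrt_bound_arith {p q s k : ℝ} (hp : 1 ≤ p) (hpq : p ≤ q) (hs0 : 0 < s)
    (hs : p ≤ s * q) (hk0 : 0 ≤ k) (hk : k ≤ 3 * q ^ 3) :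
    k * (26 * √(p ^ 3 / s) * (16 * √k)) ≤ 2500 * (p * q ^ 5) := by
  have h0 : 0 < q := by linarith
  have hw : p ^ 3 / s ≤ p ^ 2 * q := by
    rw [div_le_iff₀ hs0]
    nlinarith [sq_nonneg p]
  have h1 : √(p ^ 3 / s) * √k ≤ 2 * (p * q ^ 2) := by
    rw [← Real.sqrt_mul (by positivity), Real.sqrt_le_iff]
    refine ⟨by positivity, ?_⟩
    calc p ^ 3 / s * k ≤ (p ^ 2 * q) * (3 * q ^ 3) := by gcongr
      _ ≤ (2 * (p * q ^ 2)) ^ 2 := by nlinarith [sq_nonneg (p * q ^ 2)]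
  calc k * (26 * √(p ^ 3 / s) * (16 * √k)) = 416 * k * (√(p ^ 3 / s) * √k) := by ring
    _ ≤ 416 * (3 * q ^ 3) * (2 * (p * q ^ 2)) := by gcongr
    _ = 2496 * (p * q ^ 5) := by ring
    _ ≤ _ := by gcongr; norm_num

lemma measure_le_of_strip_of_annuli {S : Set ((ℝ × ℝ) × (ℤ × ℤ))} {I : Finset ℤ}
    {a₁ a₂ a₃ a₄ x₀ y₀ R c d s μ lam : ℝ} (hs0 : 0 ≤ s) (hs : s ^ 2 = a₁ ^ 2 + a₂ ^ 2)
    (ha : s ^ 2 + a₃ ^ 2 + a₄ ^ 2 = 1) (hμ : 0 ≤ μ) (hlam : 0 ≤ lam)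
    (hI : 2 * s * (I.card - 1) ≤ 4 * (μ + s * lam)) (hSI : ∀ η ∈ S, η.2 ∈ I ×ˢ I)
    (hball : ∀ η ∈ S, η.1.1 ^ 2 + η.1.2 ^ 2 ≤ lam ^ 2)
    (hstrip : ∀ η ∈ S, |a₁ * η.1.1 + a₂ * η.1.2 + (a₃ * η.2.1 + a₄ * η.2.2)| ≤ μ)
    (hshell : ∀ η ∈ S, |(η.1.1 - x₀) ^ 2 + (η.1.2 - y₀) ^ 2 -
      (R - (η.2.1 - c) ^ 2 - (η.2.2 - d) ^ 2)| ≤ 1 / 2) :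
    ((volume : Measure (ℝ × ℝ)).prod (Measure.count : Measure (ℤ × ℤ))) S
      ≤ ENNReal.ofReal (I.card * (4 * (μ + s * lam) + 1) * 40) := by
  have hh : 0 ≤ μ + s * lam := by positivity
  refine (prod_count_le_sum (g := fun _ => 40)
    (K := (I ×ˢ I).filter fun k : ℤ × ℤ => |a₃ * k.1 + a₄ * k.2| ≤ μ + s * lam)
    (fun _ => by norm_num) (fun η hη => Finset.mem_filter.2 ⟨hSI η hη, ?_⟩)
    (fun k _ => (measure_mono fun x hx => hshell (x, k) hx).trans (volume_annulus_le x₀ y₀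
      (R - (k.1 - c) ^ 2 - (k.2 - d) ^ 2)))).trans (ENNReal.ofReal_le_ofReal ?_)
  · have h1 := hstrip η hη
    have h3 : |a₁ * η.1.1 + a₂ * η.1.2| ≤ s * lam := by
      apply abs_le_of_sq_le_sq _ (by positivity)
      rw [mul_pow, hs]
      calc (a₁ * η.1.1 + a₂ * η.1.2) ^ 2
          ≤ (a₁ ^ 2 + a₂ ^ 2) * (η.1.1 ^ 2 + η.1.2 ^ 2) := by
            nlinarith [sq_nonneg (a₁ * η.1.2 - a₂ * η.1.1)]
        _ ≤ (a₁ ^ 2 + a₂ ^ 2) * lam ^ 2 := by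
            gcongr
            exact hball η hη
    rw [abs_le] at *
    constructor <;> linarith
  · rw [Finset.sum_const, nsmul_eq_mul]
    exact mul_le_mul_of_nonneg_right (card_filter_product_le hs0 ha hh I hI) (by norm_num)

lemma measure_le_of_strip_inter_annuli {S : Set ((ℝ × ℝ) × (ℤ × ℤ))} (l : ℤ) (k : ℕ)
    {a₁ a₂ a₃ a₄ x₀ y₀ R c d s μ : ℝ} (hs0 : 0 < s) (hs : s ^ 2 = a₁ ^ 2 + a₂ ^ 2)
    (hsμ : s ≤ μ) (hSI : ∀ η ∈ S, η.2 ∈ Finset.Ico l (l + k) ×ˢ Finset.Ico l (l + k))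
    (hstrip : ∀ η ∈ S, |a₁ * η.1.1 + a₂ * η.1.2 + (a₃ * η.2.1 + a₄ * η.2.2)| ≤ μ)
    (hshell : ∀ η ∈ S, |(η.1.1 - x₀) ^ 2 + (η.1.2 - y₀) ^ 2 -
      (R - (η.2.1 - c) ^ 2 - (η.2.2 - d) ^ 2)| ≤ 1 / 2) :
    ((volume : Measure (ℝ × ℝ)).prod (Measure.count : Measure (ℤ × ℤ))) S
      ≤ ENNReal.ofReal (k * (26 * √(μ / s) * (16 * √k))) := by
  set M : ℤ × ℤ → ℝ := fun j => max 1 |(|(j.2 : ℝ) - d| - √(R - (j.1 - c) ^ 2))|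
  refine (prod_count_le_sum (g := fun j => 26 * (√(μ / s) / √(M j)))
    (fun _ => by positivity) hSI (fun j _ => ?_)).trans (ENNReal.ofReal_le_ofReal ?_)
  · refine (measure_mono fun x hx => ?_).trans
      (volume_slice_le_s7 (e₁ := a₁ / s) (e₂ := a₂ / s) (M := M j) ?_ x₀ y₀
        ((a₃ * j.1 + a₄ * j.2) / s) ((one_le_div₀ hs0).2 hsμ) (le_max_left _ _)
        sq_max_one_abs_sub_sqrt_le)
    · refine ⟨?_, hshell _ hx⟩
      rw [show a₁ / s * x.1 + a₂ / s * x.2 + (a₃ * j.1 + a₄ * j.2) / s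
        = (a₁ * x.1 + a₂ * x.2 + (a₃ * j.1 + a₄ * j.2)) / s by ring, abs_div, abs_of_pos hs0]
      exact div_le_div_of_nonneg_right (hstrip _ hx) hs0.le
    · rw [div_pow, div_pow, ← add_div, ← hs, div_self (by positivity)]
  · rw [Finset.sum_product]
    have hcard : (Finset.Ico l (l + k)).card = k := by simp
    refine (Finset.sum_le_card_nsmul _ _ (26 * √(μ / s) * (16 * √k)) fun m _ => ?_).trans_eq
      (by rw [hcard, nsmul_eq_mul])
    calc ∑ n ∈ Finset.Ico l (l + k), 26 * (√(μ / s) / √(M (m, n)))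
        = 26 * √(μ / s) * ∑ n ∈ Finset.Ico l (l + k), 1 / √(M (m, n)) := by
          rw [Finset.mul_sum]
          exact Finset.sum_congr rfl fun n _ => by ring
      _ ≤ _ := mul_le_mul_of_nonneg_left
          (sum_inv_sqrt_max_abs_abs_sub_le d (√(R - (m - c) ^ 2)) l k) (by positivity)

/-- There is an absolute constant `C > 0` such that for all `1 ≤ μ ≤ λ`, every unit vector
`a ∈ ℝ⁴`, every `τ ∈ ℝ` and every `ξ ∈ ℝ² × ℤ²`, the set
`B(τ,ξ) = {η ∈ ℝ² × ℤ² : |a·η| ≤ μ, |η| ≤ λ, |τ + |η|² + |ξ−η|²| ≤ 1}` has measure at most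
`C μ^{1/3} λ^{5/3}` (Lebesgue measure on `ℝ²` × counting measure on `ℤ²`). -/
theorem stmt_7 :
    ∃ C : ℝ, 0 < C ∧ ∀ (μ lam : ℝ) (a : Fin 4 → ℝ) (τ : ℝ) (ξ : (ℝ × ℝ) × (ℤ × ℤ)),
      1 ≤ μ → μ ≤ lam → (∑ i, a i ^ 2 = 1) →
      ((volume : Measure (ℝ × ℝ)).prod (Measure.count : Measure (ℤ × ℤ)))
        {η : (ℝ × ℝ) × (ℤ × ℤ) |
          |∑ i, a i * embR2Z2 η i| ≤ μ ∧
          Real.sqrt (∑ i, embR2Z2 η i ^ 2) ≤ lam ∧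
          |τ + (∑ i, embR2Z2 η i ^ 2) + ∑ i, (embR2Z2 ξ i - embR2Z2 η i) ^ 2| ≤ 1}
      ≤ ENNReal.ofReal (C * μ ^ ((1 : ℝ) / 3) * lam ^ ((5 : ℝ) / 3)) := by
  refine ⟨2500, by norm_num, fun μ lam a τ ξ hμ hlam ha => ?_⟩
  obtain ⟨p, hp, hpμ⟩ : ∃ p : ℝ, 1 ≤ p ∧ p = μ ^ ((1 : ℝ) / 3) :=
    ⟨_, Real.one_le_rpow hμ (by norm_num), rfl⟩
  have hp3 : p ^ 3 = μ := by
    rw [hpμ, ← Real.rpow_natCast, ← Real.rpow_mul (by linarith)]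
    norm_num
  obtain ⟨q, hpq, hqlam⟩ : ∃ q : ℝ, p ≤ q ∧ q = lam ^ ((1 : ℝ) / 3) :=
    ⟨_, hpμ ▸ Real.rpow_le_rpow (by linarith) hlam (by norm_num), rfl⟩
  have hq3 : q ^ 3 = lam := by
    rw [hqlam, ← Real.rpow_natCast, ← Real.rpow_mul (by linarith)]
    norm_num
  have hq5 : lam ^ ((5 : ℝ) / 3) = q ^ 5 := by
    rw [hqlam, ← Real.rpow_natCast, ← Real.rpow_mul (by linarith)]
    norm_num
  rw [← hpμ, hq5, mul_assoc]
  set S : Set ((ℝ × ℝ) × (ℤ × ℤ)) := {η | _}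
  set R : ℝ := -(τ + (ξ.1.1 ^ 2 + ξ.1.2 ^ 2 + ξ.2.1 ^ 2 + ξ.2.2 ^ 2) / 2) / 2 with hR
  have hmem : ∀ η ∈ S, |a 0 * η.1.1 + a 1 * η.1.2 + (a 2 * η.2.1 + a 3 * η.2.2)| ≤ μ ∧
      η.1.1 ^ 2 + η.1.2 ^ 2 + η.2.1 ^ 2 + η.2.2 ^ 2 ≤ lam ^ 2 ∧
      |(η.1.1 - ξ.1.1 / 2) ^ 2 + (η.1.2 - ξ.1.2 / 2) ^ 2 -
        (R - (η.2.1 - ξ.2.1 / 2) ^ 2 - (η.2.2 - ξ.2.2 / 2) ^ 2)| ≤ 1 / 2 := by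
    rintro η ⟨h1, h2, h3⟩
    rw [Real.sqrt_le_left (by linarith)] at h2
    simp only [Fin.sum_univ_four, embR2Z2, Matrix.cons_val] at h1 h2 h3
    refine ⟨by rwa [← add_assoc], h2, ?_⟩
    rw [abs_le] at h3 ⊢
    constructor <;> linarith
  clear_value S
  simp only [Fin.sum_univ_four] at ha
  obtain ⟨N, hN⟩ : ∃ N : ℕ, N = ⌊lam⌋₊ := ⟨_, rfl⟩
  have hNlam : (N : ℝ) ≤ lam := hN ▸ Nat.floor_le (by linarith)
  set k : ℕ := 2 * N + 1 with hk
  have hk3 : (k : ℝ) ≤ 3 * q ^ 3 := by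
    rw [hq3, hk]; push_cast; linarith
  set I : Finset ℤ := Finset.Ico (-(N : ℤ)) (-N + k) with hI
  have hIcard : I.card = k := by simp [hI]
  have hImem : ∀ n : ℤ, (n : ℝ) ^ 2 ≤ lam ^ 2 → n ∈ I := by
    intro n hn
    have h1 : (n.natAbs : ℝ) ≤ lam := by
      rw [Nat.cast_natAbs, Int.cast_abs]
      exact abs_le_of_sq_le_sq hn (by linarith)
    have h2 := Nat.le_floor h1
    rw [hI, Finset.mem_Ico]
    omega
  have hSI : ∀ η ∈ S, η.2 ∈ I ×ˢ I := by
    intro η hη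
    have h := (hmem η hη).2.1
    rw [Finset.mem_product]
    constructor <;> apply hImem <;>
      nlinarith [sq_nonneg η.1.1, sq_nonneg η.1.2, sq_nonneg (η.2.1 : ℝ), sq_nonneg (η.2.2 : ℝ)]
  set s : ℝ := √(a 0 ^ 2 + a 1 ^ 2)
  have hs2 : s ^ 2 = a 0 ^ 2 + a 1 ^ 2 := Real.sq_sqrt (by positivity)
  have hs0 : 0 ≤ s := Real.sqrt_nonneg _
  rcases le_or_gt (s * q) p with hsq | hsq
  · refine (measure_le_of_strip_of_annuli (lam := lam) hs0 hs2 (by linarith) (by linarith)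
      (by linarith) ?_ hSI (fun η hη => ?_) (fun η hη => (hmem η hη).1)
      (fun η hη => (hmem η hη).2.2)).trans (ENNReal.ofReal_le_ofReal ?_)
    · rw [hIcard, hk]
      push_cast
      nlinarith
    · have := (hmem η hη).2.1
      nlinarith [sq_nonneg (η.2.1 : ℝ), sq_nonneg (η.2.2 : ℝ)]
    · rw [hIcard, ← hp3, ← hq3]
      exact card_bound_arith hp hpq hs0 hsq hk3
  · have hs0' : 0 < s := by
      by_contra! h
      nlinarith
    have hs1 : s ≤ 1 := by nlinarith [sq_nonneg (a 2), sq_nonneg (a 3)]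
    refine (measure_le_of_strip_inter_annuli (-(N : ℤ)) k hs0' hs2 (hs1.trans hμ) hSI
      (fun η hη => (hmem η hη).1) (fun η hη => (hmem η hη).2.2)).trans
      (ENNReal.ofReal_le_ofReal ?_)
    rw [← hp3]
    exact sqrt_bound_arith hp hpq hs0' hsq.le k.cast_nonneg hk3
end

section
/- There is an absolute constant C > 0 such that for all real numbers b ≥ 1 and τ, d, e ∈ ℝ, the set {(x, n) ∈ ℝ × ℤ : |τ + (x − d)² + b (n − e)²| ≤ 1} has measure at most C √b, where ℝ × ℤ carries the product of the one-dimensional Lebesgue measure on ℝ and the counting measure on ℤ. -/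
open MeasureTheory

/-- The shell `u - 2 ≤ (x - d)² ≤ u` is covered by two intervals. -/
lemma volume_sq_shell_le (u d : ℝ) :
    volume {x : ℝ | u - 2 ≤ (x - d) ^ 2 ∧ (x - d) ^ 2 ≤ u}
      ≤ ENNReal.ofReal (2 * (√u - √(u - 2))) := by
  have hle : √(u - 2) ≤ √u := Real.sqrt_le_sqrt (by linarith)
  have hsub : {x : ℝ | u - 2 ≤ (x - d) ^ 2 ∧ (x - d) ^ 2 ≤ u} ⊆
      Set.Icc (d + √(u - 2)) (d + √u) ∪ Set.Icc (d - √u) (d - √(u - 2)) := by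
    rintro x ⟨h1, h2⟩
    have h3 := Real.sqrt_le_sqrt h1
    have h4 := Real.sqrt_le_sqrt h2
    rw [Real.sqrt_sq_eq_abs] at h3 h4
    rcases abs_cases (x - d) with ⟨h, _⟩ | ⟨h, _⟩ <;> rw [h] at h3 h4
    · exact Or.inl ⟨by linarith, by linarith⟩
    · exact Or.inr ⟨by linarith, by linarith⟩
  refine (measure_mono hsub).trans ((measure_union_le _ _).trans ?_)
  rw [Real.volume_Icc, Real.volume_Icc, ← ENNReal.ofReal_add (by linarith) (by linarith)]
  exact ENNReal.ofReal_le_ofReal (by linarith)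

lemma sqrt_sub_sqrt_sub_two_le {u w : ℝ} (hw : 0 < w) (hwu : w ≤ u) :
    √u - √(u - 2) ≤ 2 / √w := by
  have hw' : 0 < √w := Real.sqrt_pos.2 hw
  have hwu' : √w ≤ √u := Real.sqrt_le_sqrt hwu
  have hu : √u ^ 2 = u := Real.sq_sqrt (by linarith)
  have h0 : 0 ≤ √(u - 2) := Real.sqrt_nonneg _
  rw [le_div_iff₀ hw']
  have hle : √(u - 2) ≤ √u := Real.sqrt_le_sqrt (by linarith)
  have h2 : u - 2 ≤ √(u - 2) ^ 2 := by
    rcases le_total 0 (u - 2) with h | h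
    · rw [Real.sq_sqrt h]
    · nlinarith
  nlinarith [mul_le_mul_of_nonneg_left hwu' (sub_nonneg.2 hle)]

lemma two_mul_sqrt_sub_sqrt_sub_two_le (u : ℝ) : 2 * (√u - √(u - 2)) ≤ 4 := by
  have h0 : 0 ≤ √(u - 2) := Real.sqrt_nonneg _
  rcases le_total u 1 with h | h
  · have := Real.sqrt_le_sqrt h
    rw [Real.sqrt_one] at this
    linarith
  · have := sqrt_sub_sqrt_sub_two_le one_pos h
    rw [Real.sqrt_one] at this
    linarith

lemma sum_range_one_div_sqrt_succ_le (N : ℕ) :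
    ∑ i ∈ Finset.range N, 1 / √((i : ℝ) + 1) ≤ 2 * √N := by
  induction N with
  | zero => simp
  | succ N ih =>
    rw [Finset.sum_range_succ]
    have h1 : 0 < √((N : ℝ) + 1) := Real.sqrt_pos.2 (by positivity)
    have h2 : √((N : ℝ) + 1) ^ 2 = N + 1 := Real.sq_sqrt (by positivity)
    have h3 : √(N : ℝ) ^ 2 = N := Real.sq_sqrt (by positivity)
    have h4 : 1 / √((N : ℝ) + 1) ≤ 2 * (√((N : ℝ) + 1) - √N) := by
      rw [div_le_iff₀ h1]
      nlinarith [sq_nonneg (√((N : ℝ) + 1) - √N)]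
    push_cast
    linarith

/-- A majorant for the length of a slice at distance at least `j` from the boundary of an interval
of half-length `A`. -/
noncomputable def sliceBound (A : ℝ) (j : ℤ) : ENNReal :=
  if 0 ≤ j ∧ (j : ℝ) ≤ A then ENNReal.ofReal (if j = 0 then 4 else 4 / √(j * A)) else 0

lemma tsum_sliceBound_le {A : ℝ} (hA : 0 ≤ A) :
    ∑' j, sliceBound A j ≤ ENNReal.ofReal 12 := by
  have hsupp : Function.support (sliceBound A) ⊆ Set.range (Nat.cast : ℕ → ℤ) := by
    intro j hj
    have : 0 ≤ j := by
      by_contra h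
      exact hj (if_neg fun h' => h h'.1)
    exact ⟨j.toNat, Int.toNat_of_nonneg this⟩
  rw [← Function.Injective.tsum_eq Nat.cast_injective hsupp,
    tsum_eq_sum (s := Finset.range (⌊A⌋₊ + 1)), Finset.sum_range_succ']
  · have hzero : sliceBound A ((0 : ℕ) : ℤ) = ENNReal.ofReal 4 := by simp [sliceBound, hA]
    have hsucc : ∀ i ∈ Finset.range ⌊A⌋₊, sliceBound A ((i + 1 : ℕ) : ℤ)
        ≤ ENNReal.ofReal (4 / √A * (1 / √((i : ℝ) + 1))) := by
      intro i _
      unfold sliceBound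
      split_ifs with h1 h2
      · omega
      · refine ENNReal.ofReal_le_ofReal (le_of_eq ?_)
        push_cast
        rw [Real.sqrt_mul (by positivity), div_mul_div_comm, mul_one, mul_comm]
      · exact zero_le
    rw [hzero]
    refine (add_le_add_left (Finset.sum_le_sum hsucc) _).trans ?_
    rw [← ENNReal.ofReal_sum_of_nonneg (fun _ _ => by positivity),
      ← ENNReal.ofReal_add (Finset.sum_nonneg fun _ _ => by positivity) (by norm_num),
      ← Finset.mul_sum]
    refine ENNReal.ofReal_le_ofReal ?_
    have hfloor : √(⌊A⌋₊ : ℝ) ≤ √A := Real.sqrt_le_sqrt (Nat.floor_le hA)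
    have hsum := (sum_range_one_div_sqrt_succ_le ⌊A⌋₊).trans
      (mul_le_mul_of_nonneg_left hfloor zero_le_two)
    have hmul := mul_le_mul_of_nonneg_left hsum (by positivity : 0 ≤ 4 / √A)
    have hdiv : 4 / √A * (2 * √A) ≤ 8 := by
      rcases (Real.sqrt_nonneg A).eq_or_lt with h | h
      · rw [← h]; norm_num
      · field_simp; norm_num
    linarith
  · intro j hj
    refine if_neg fun h => hj ?_
    rw [Finset.mem_range, Nat.lt_succ_iff, Nat.le_floor_iff hA]
    exact_mod_cast h.2

/-- The slice of the shell at a point with `A² - m² ≥ j A` is controlled by `sliceBound A j`. -/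
lemma volume_slice_le_sliceBound {A b v d : ℝ} {j : ℤ} (hb : 1 ≤ b) (hj : 0 ≤ j)
    (hjA : (j : ℝ) ≤ A) (hv : b * (j * A) ≤ v) :
    volume {x : ℝ | v - 2 ≤ (x - d) ^ 2 ∧ (x - d) ^ 2 ≤ v} ≤ sliceBound A j := by
  refine (volume_sq_shell_le v d).trans ?_
  rw [sliceBound, if_pos ⟨hj, hjA⟩]
  refine ENNReal.ofReal_le_ofReal ?_
  split_ifs with h
  · exact two_mul_sqrt_sub_sqrt_sub_two_le v
  · have hj' : (0 : ℝ) < j := by exact_mod_cast lt_of_le_of_ne hj (Ne.symm h)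
    have hpos : 0 < (j : ℝ) * A := mul_pos hj' (hj'.trans_le hjA)
    have := sqrt_sub_sqrt_sub_two_le hpos ((le_mul_of_one_le_left hpos.le hb).trans hv)
    have h4 : 4 / √(j * A) = 2 * (2 / √(j * A)) := by ring
    linarith

lemma volume_slice_le_s8 {b u d e : ℝ} (hb : 1 ≤ b) (n : ℤ) :
    volume {x : ℝ | u - b * (n - e) ^ 2 - 2 ≤ (x - d) ^ 2 ∧ (x - d) ^ 2 ≤ u - b * (n - e) ^ 2}
      ≤ sliceBound √(u / b) (⌊e + √(u / b)⌋ - n) + sliceBound √(u / b) (n - ⌈e - √(u / b)⌉) := by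
  have hb0 : 0 < b := by linarith
  rcases lt_or_ge (u - b * (n - e) ^ 2) 0 with hneg | hpos
  · rw [show {x : ℝ | u - b * (n - e) ^ 2 - 2 ≤ (x - d) ^ 2 ∧ (x - d) ^ 2 ≤ u - b * (n - e) ^ 2}
      = ∅ from Set.eq_empty_of_forall_notMem fun x hx =>
        absurd (hx.2.trans_lt hneg) (not_lt.2 (sq_nonneg _)), measure_empty]
    exact zero_le
  have hmu : ((n : ℝ) - e) ^ 2 ≤ u / b := by rw [le_div_iff₀ hb0]; linarith
  have hu : 0 ≤ u / b := (sq_nonneg _).trans hmu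
  have hm := Real.abs_le_sqrt hmu
  have hub : b * √(u / b) ^ 2 = u := by rw [Real.sq_sqrt hu]; field_simp
  set A := √(u / b)
  obtain ⟨hm1, hm2⟩ := abs_le.1 hm
  have key : ∀ t : ℝ, t * A ≤ A ^ 2 - (n - e) ^ 2 → b * (t * A) ≤ u - b * (n - e) ^ 2 := by
    intro t ht
    nlinarith [mul_le_mul_of_nonneg_left ht hb0.le]
  rcases le_total e n with hen | hen
  · refine (volume_slice_le_sliceBound hb (j := ⌊e + A⌋ - n) ?_ ?_ (key _ ?_)).trans
      le_self_add
    · exact sub_nonneg.2 (Int.le_floor.2 (by linarith))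
    · push_cast; linarith [Int.floor_le (e + A)]
    · push_cast
      nlinarith [mul_nonneg (sub_nonneg.2 (Int.floor_le (e + A))) (Real.sqrt_nonneg (u / b)),
        mul_nonneg (sub_nonneg.2 hm2) (sub_nonneg.2 hen)]
  · refine (volume_slice_le_sliceBound hb (j := n - ⌈e - A⌉) ?_ ?_ (key _ ?_)).trans
      le_add_self
    · exact sub_nonneg.2 (Int.ceil_le.2 (by linarith))
    · push_cast; linarith [Int.le_ceil (e - A)]
    · push_cast
      nlinarith [mul_nonneg (sub_nonneg.2 (Int.le_ceil (e - A))) (Real.sqrt_nonneg (u / b)),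
        mul_nonneg (neg_le_iff_add_nonneg.1 hm1) (sub_nonneg.2 hen)]

/-- There is an absolute constant `C > 0` such that for all reals `b ≥ 1` and `τ, d, e ∈ ℝ`,
the set `{(x, n) ∈ ℝ × ℤ : |τ + (x − d)² + b (n − e)²| ≤ 1}` has measure at most `C √b`
(Lebesgue × counting measure). -/
theorem stmt_8 :
    ∃ C : ℝ, 0 < C ∧ ∀ b τ d e : ℝ, 1 ≤ b →
      ((volume : Measure ℝ).prod (Measure.count : Measure ℤ))
        {p : ℝ × ℤ | |τ + (p.1 - d) ^ 2 + b * ((p.2 : ℝ) - e) ^ 2| ≤ 1}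
      ≤ ENNReal.ofReal (C * Real.sqrt b) := by
  refine ⟨24, by norm_num, fun b τ d e hb => ?_⟩
  have hmeas : MeasurableSet
      {p : ℝ × ℤ | |τ + (p.1 - d) ^ 2 + b * ((p.2 : ℝ) - e) ^ 2| ≤ 1} :=
    (isClosed_le (by fun_prop) continuous_const).measurableSet
  rw [Measure.prod_apply_symm hmeas, lintegral_count]
  have hslice : ∀ n : ℤ, volume ((fun x : ℝ => (x, n)) ⁻¹'
      {p : ℝ × ℤ | |τ + (p.1 - d) ^ 2 + b * ((p.2 : ℝ) - e) ^ 2| ≤ 1})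
      ≤ sliceBound √((1 - τ) / b) (⌊e + √((1 - τ) / b)⌋ - n)
        + sliceBound √((1 - τ) / b) (n - ⌈e - √((1 - τ) / b)⌉) := by
    intro n
    refine (measure_mono fun x hx => ?_).trans (volume_slice_le_s8 (d := d) hb n)
    have hx' : |τ + (x - d) ^ 2 + b * ((n : ℝ) - e) ^ 2| ≤ 1 := hx
    obtain ⟨h1, h2⟩ := abs_le.1 hx'
    exact ⟨by linarith, by linarith⟩
  refine (ENNReal.tsum_le_tsum hslice).trans ?_
  rw [ENNReal.tsum_add]
  have hleft := (Equiv.subLeft ⌊e + √((1 - τ) / b)⌋).tsum_eq (sliceBound √((1 - τ) / b))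
  have hright := (Equiv.subRight ⌈e - √((1 - τ) / b)⌉).tsum_eq (sliceBound √((1 - τ) / b))
  simp only [Equiv.subLeft_apply, Equiv.subRight_apply] at hleft hright
  rw [hleft, hright]
  refine (add_le_add (tsum_sliceBound_le (Real.sqrt_nonneg _))
    (tsum_sliceBound_le (Real.sqrt_nonneg _))).trans ?_
  rw [← ENNReal.ofReal_add (by norm_num) (by norm_num)]
  refine ENNReal.ofReal_le_ofReal ?_
  linarith [Real.one_le_sqrt.2 hb]
end

section
/- Let ν, μ > 0, let k be an integer with |k| ≥ 1 and μ² ≤ ν² |k|, let a ∈ ℝ⁴ be a unit vector, and let ξ₀ = r a for some r > 0. If ξ ∈ ℝ⁴ satisfies |ξ_i − (ξ₀)_i| ≤ μ for each coordinate i = 1, …, 4 and |ξ·a − ν k| ≤ ν, then | |ξ|² − ν² k² | ≤ 20 ν² |k|. -/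
theorem sum_sub_smul_sq {ι : Type*} [Fintype ι] {a : ι → ℝ} (ha : ∑ i, a i ^ 2 = 1)
    (ξ : ι → ℝ) (t : ℝ) :
    ∑ i, (ξ i - t * a i) ^ 2 = ∑ i, ξ i ^ 2 - 2 * t * ∑ i, ξ i * a i + t ^ 2 := by
  have h : ∀ i, (ξ i - t * a i) ^ 2 = ξ i ^ 2 - 2 * t * (ξ i * a i) + t ^ 2 * a i ^ 2 :=
    fun i => by ring
  simp only [h, Finset.sum_add_distrib, Finset.sum_sub_distrib, ← Finset.mul_sum, ha, mul_one]

/-- Algebraic localization estimate: let `ν, μ > 0`, `k ∈ ℤ` with `|k| ≥ 1` and `μ² ≤ ν² |k|`,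
let `a ∈ ℝ⁴` be a unit vector and `ξ₀ = r a` with `r > 0`. If `ξ ∈ ℝ⁴` satisfies
`|ξᵢ − (ξ₀)ᵢ| ≤ μ` for each coordinate `i` and `|ξ·a − ν k| ≤ ν`, then
`| |ξ|² − ν² k² | ≤ 20 ν² |k|`. -/
theorem stmt_10 (ν μ : ℝ) (hν : 0 < ν) (hμ : 0 < μ) (k : ℤ) (hk : 1 ≤ |k|)
    (hμk : μ ^ 2 ≤ ν ^ 2 * |(k : ℝ)|) (a : Fin 4 → ℝ) (ha : ∑ i, a i ^ 2 = 1)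
    (r : ℝ) (hr : 0 < r) (ξ₀ : Fin 4 → ℝ) (hξ₀ : ξ₀ = r • a) (ξ : Fin 4 → ℝ)
    (hbox : ∀ i, |ξ i - ξ₀ i| ≤ μ)
    (hdot : |(∑ i, ξ i * a i) - ν * (k : ℝ)| ≤ ν) :
    |(∑ i, ξ i ^ 2) - ν ^ 2 * (k : ℝ) ^ 2| ≤ 20 * ν ^ 2 * |(k : ℝ)| := by
  subst hξ₀
  have hk' : (1 : ℝ) ≤ |(k : ℝ)| := by exact_mod_cast hk
  have hbox_sum : ∑ i, (ξ i - r * a i) ^ 2 ≤ 4 * μ ^ 2 := by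
    calc ∑ i, (ξ i - r * a i) ^ 2 ≤ ∑ _i : Fin 4, μ ^ 2 :=
          Finset.sum_le_sum fun i _ => sq_le_sq' (abs_le.mp (hbox i)).1 (abs_le.mp (hbox i)).2
      _ = 4 * μ ^ 2 := by simp
  have hperp : 0 ≤ ∑ i, (ξ i - (∑ j, ξ j * a j) * a i) ^ 2 :=
    Finset.sum_nonneg fun i _ => sq_nonneg _
  rw [sum_sub_smul_sq ha] at hbox_sum hperp
  generalize ∑ i, ξ i * a i = s at *
  generalize ∑ i, ξ i ^ 2 = S at *
  have hpar : |s ^ 2 - ν ^ 2 * (k : ℝ) ^ 2| ≤ 3 * ν ^ 2 * |(k : ℝ)| := by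
    have hplus : |s + ν * k| ≤ 3 * ν * |(k : ℝ)| := by
      calc |s + ν * k| = |(s - ν * k) + 2 * ν * k| := by ring_nf
        _ ≤ |s - ν * k| + |2 * ν * k| := abs_add_le _ _
        _ = |s - ν * k| + 2 * ν * |(k : ℝ)| := by
          rw [abs_mul, abs_of_pos (by positivity : 0 < 2 * ν)]
        _ ≤ 3 * ν * |(k : ℝ)| := by nlinarith
    calc |s ^ 2 - ν ^ 2 * (k : ℝ) ^ 2| = |s - ν * k| * |s + ν * k| := by
          rw [← abs_mul]; ring_nf
      _ ≤ ν * (3 * ν * |(k : ℝ)|) := by gcongr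
      _ = 3 * ν ^ 2 * |(k : ℝ)| := by ring
  have hpos : 0 ≤ ν ^ 2 * |(k : ℝ)| := by positivity
  obtain ⟨hlo, hhi⟩ := abs_le.mp hpar
  exact abs_le.mpr ⟨by nlinarith, by nlinarith [sq_nonneg (s - r)]⟩
end
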